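/- arXiv:2308.06380 — 10 statements merged into one kernel-verified Lean document; each statement's English description precedes it below -/
import Mathlib

section
/- Let V : ℝ³ ∖ {0} → ℝ be measurable with V(−x) = V(x), and suppose there exist constants a > 0, C₁ > 0, C₂ > 0 and ε > 0 such that V(x) ≥ C₁/|x|^{3+ε} whenever 0 < |x| ≤ a, and |V(x)| ≤ C₂/|x|^{3+ε} whenever |x| > a (a Lennard-Jones type potential). Then V is stable: there exists B ≥ 0 such that for every n ≥ 2 and all pairwise distinct x_1, …, x_n ∈ ℝ³, ∑_{1≤i<j≤n} V(x_i − x_j) ≥ −B n. -/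
open scoped BigOperators

noncomputable section
open Classical

/-- The total pair interaction energy `∑_{1 ≤ i < j ≤ n} V (x i - x j)` of a
configuration of `n` particles in `ℝ^d`. -/
def pairEnergy {d : ℕ} (V : EuclideanSpace ℝ (Fin d) → ℝ) {n : ℕ}
    (x : Fin n → EuclideanSpace ℝ (Fin d)) : ℝ :=
  ∑ p ∈ Finset.univ.filter (fun p : Fin n × Fin n => p.1 < p.2), V (x p.1 - x p.2)

lemma aux_sum_count {ι α : Type*} [Fintype ι] (Q : ι → α) (w : α → α → ℝ) :
    ∑ i, ∑ j, w (Q i) (Q j) =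
      ∑ q ∈ Finset.univ.image Q, ∑ q' ∈ Finset.univ.image Q,
        (∑ i, if Q i = q then (1:ℝ) else 0) * (∑ j, if Q j = q' then (1:ℝ) else 0) * w q q' := by
  have key : ∀ f : α → ℝ, ∑ i, f (Q i) =
      ∑ q ∈ Finset.univ.image Q, (∑ i, if Q i = q then (1:ℝ) else 0) * f q := by
    intro f
    simp_rw [Finset.sum_mul]
    rw [Finset.sum_comm]
    refine Finset.sum_congr rfl fun i _ => ?_
    simp
  rw [Finset.sum_congr rfl fun i _ => key (fun q' => w (Q i) q')]
  rw [key (fun q => ∑ q' ∈ Finset.univ.image Q, (∑ j, if Q j = q' then (1:ℝ) else 0) * w q q')]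
  refine Finset.sum_congr rfl fun q _ => ?_
  rw [Finset.mul_sum]
  refine Finset.sum_congr rfl fun q' _ => ?_
  ring

lemma aux_diag {ι α : Type*} [Fintype ι] (Q : ι → α) :
    ∑ i, ∑ j, (if Q i = Q j then (1:ℝ) else 0) =
      ∑ q ∈ Finset.univ.image Q, (∑ i, if Q i = q then (1:ℝ) else 0) ^ 2 := by
  rw [aux_sum_count Q (fun p q => if p = q then (1:ℝ) else 0)]
  refine Finset.sum_congr rfl fun q hq => ?_
  simp only [mul_ite, mul_one, mul_zero]
  rw [Finset.sum_ite_eq, if_pos hq, sq]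

lemma aux_fine {ι α β : Type*} [Fintype ι] [Fintype β] (Q : ι → α) (r : ι → β) :
    ∑ i, ∑ j, (if Q i = Q j then (1:ℝ) else 0) ≤
      (Fintype.card β : ℝ) * ∑ i, ∑ j, (if Q i = Q j ∧ r i = r j then (1:ℝ) else 0) := by
  have h2 : ∑ i, ∑ j, (if Q i = Q j ∧ r i = r j then (1:ℝ) else 0) =
      ∑ q ∈ Finset.univ.image Q, ∑ b : β, (∑ i, if Q i = q ∧ r i = b then (1:ℝ) else 0) ^ 2 := by
    simp_rw [sq, Finset.sum_mul_sum]
    have : ∀ q, ∑ b : β, ∑ i, ∑ j, (if Q i = q ∧ r i = b then (1:ℝ) else 0) *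
        (if Q j = q ∧ r j = b then (1:ℝ) else 0) =
        ∑ i, ∑ j, (if Q i = q then (if Q i = Q j ∧ r i = r j then (1:ℝ) else 0) else 0) := by
      intro q
      rw [Finset.sum_comm]
      refine Finset.sum_congr rfl fun i _ => ?_
      rw [Finset.sum_comm]
      refine Finset.sum_congr rfl fun j _ => ?_
      rw [Finset.sum_eq_single (r i)]
      · grind
      · intro b _ hb
        rw [if_neg (fun h => hb h.2.symm), zero_mul]
      · simp
    simp_rw [this]
    symm
    rw [Finset.sum_comm]
    refine Finset.sum_congr rfl fun i _ => ?_
    rw [Finset.sum_comm]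
    refine Finset.sum_congr rfl fun j _ => ?_
    rw [Finset.sum_ite_eq, if_pos (by simp)]
  rw [aux_diag, h2, Finset.mul_sum]
  refine Finset.sum_le_sum fun q _ => ?_
  have h3 : (∑ i, if Q i = q then (1:ℝ) else 0) =
      ∑ b : β, ∑ i, if Q i = q ∧ r i = b then (1:ℝ) else 0 := by
    rw [Finset.sum_comm]
    refine Finset.sum_congr rfl fun i _ => ?_
    by_cases h : Q i = q <;> simp [h]
  rw [h3]
  have h4 := sq_sum_le_card_mul_sum_sq (s := (Finset.univ : Finset β))
    (f := fun b => ∑ i, if Q i = q ∧ r i = b then (1:ℝ) else 0)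
  rwa [Finset.card_univ] at h4

lemma aux_schur {ι α : Type*} [Fintype ι] (Q : ι → α) (w : α → α → ℝ) (W : ℝ)
    (hw : ∀ p q, 0 ≤ w p q) (hs : ∀ p q, w p q = w q p)
    (hW : ∀ (p : α) (T : Finset α), ∑ q ∈ T, w p q ≤ W) :
    ∑ i, ∑ j, w (Q i) (Q j) ≤ W * ∑ i, ∑ j, (if Q i = Q j then (1:ℝ) else 0) := by
  rw [aux_diag, aux_sum_count]
  set T := Finset.univ.image Q
  set M : α → ℝ := fun q => ∑ i, if Q i = q then (1:ℝ) else 0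
  have h1 : ∑ p ∈ T, ∑ q ∈ T, M p * M q * w p q ≤
      ∑ p ∈ T, ∑ q ∈ T, (M p ^ 2 * w p q / 2 + M q ^ 2 * w p q / 2) := by
    refine Finset.sum_le_sum fun p _ => Finset.sum_le_sum fun q _ => ?_
    nlinarith [mul_nonneg (sq_nonneg (M p - M q)) (hw p q)]
  have h2 : ∑ p ∈ T, ∑ q ∈ T, M q ^ 2 * w p q / 2 = ∑ p ∈ T, ∑ q ∈ T, M p ^ 2 * w p q / 2 := by
    rw [Finset.sum_comm]
    refine Finset.sum_congr rfl fun p _ => Finset.sum_congr rfl fun q _ => ?_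
    rw [hs]
  refine h1.trans ?_
  simp_rw [Finset.sum_add_distrib]
  rw [h2, ← Finset.sum_add_distrib, Finset.mul_sum]
  refine Finset.sum_le_sum fun p _ => ?_
  rw [← Finset.sum_div, ← Finset.mul_sum, add_halves, mul_comm]
  exact mul_le_mul_of_nonneg_right (hW p T) (sq_nonneg _)

lemma aux_pairs {n : ℕ} (g : Fin n → Fin n → ℝ) (hg : ∀ i j, g i j = g j i) :
    ∑ i, ∑ j, g i j =
      2 * ∑ p ∈ Finset.univ.filter (fun p : Fin n × Fin n => p.1 < p.2), g p.1 p.2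
        + ∑ i, g i i := by
  rw [Finset.sum_filter, Fintype.sum_prod_type]
  have h1 : ∀ i j, g i j = (if i < j then g i j else 0) + (if j < i then g j i else 0)
      + (if i = j then g i i else 0) := by
    intro i j
    rcases lt_trichotomy i j with h | h | h
    · simp [h, h.not_gt, h.ne]
    · subst h; simp
    · simp [h, h.not_gt, h.ne', hg i j]
  rw [Finset.sum_congr rfl fun i _ => Finset.sum_congr rfl fun j _ => h1 i j]
  simp_rw [Finset.sum_add_distrib]
  rw [Finset.sum_comm (f := fun i j => if j < i then g j i else 0)]
  simp
  ring

lemma aux_summable (c s : ℝ) (hc : 0 < c) (hs : 1 < s) :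
    Summable (fun t : ℤ => (c * (1 + |(t:ℝ)|)) ^ (-s)) := by
  have h0 : Summable (fun n : ℕ => (c * (1 + (n:ℝ))) ^ (-s)) := by
    have h1 : Summable (fun n : ℕ => ((n:ℝ)) ^ (-s)) := Real.summable_nat_rpow.2 (by linarith)
    have h2 := ((summable_nat_add_iff 1).2 h1).mul_left (c ^ (-s))
    refine h2.congr fun n => ?_
    rw [← Real.mul_rpow hc.le (by positivity)]
    push_cast
    rw [add_comm (1:ℝ)]
  refine Summable.of_nat_of_neg ?_ ?_
  · simpa using h0
  · simpa using h0

lemma aux_w_bound (u : ℤ → ℝ) (hu : ∀ t, 0 ≤ u t) (hsum : Summable u)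
    (p : Fin 3 → ℤ) (T : Finset (Fin 3 → ℤ)) :
    ∑ q ∈ T, ∏ m, u (p m - q m) ≤ (∑' t, u t) ^ 3 := by
  let S : Fin 3 → Finset ℤ := fun m => T.image (fun q => q m)
  have hsub : T ⊆ Fintype.piFinset S := by
    intro q hq
    rw [Fintype.mem_piFinset]
    intro m
    exact Finset.mem_image_of_mem _ hq
  calc ∑ q ∈ T, ∏ m, u (p m - q m) ≤ ∑ q ∈ Fintype.piFinset S, ∏ m, u (p m - q m) :=
        Finset.sum_le_sum_of_subset_of_nonneg hsub
          fun q _ _ => Finset.prod_nonneg fun m _ => hu _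
    _ = ∏ m, ∑ t ∈ S m, u (p m - t) := by
        rw [Finset.prod_univ_sum]
    _ ≤ ∏ m : Fin 3, (∑' t, u t) := by
        refine Finset.prod_le_prod (fun m _ => Finset.sum_nonneg fun t _ => hu _) fun m _ => ?_
        have hinj : Function.Injective (fun t : ℤ => p m - t) := fun x y h => by
          simpa using h
        rw [← Finset.sum_image (f := u) (g := fun t => p m - t) (fun x _ y _ h => hinj h)]
        exact hsum.sum_le_tsum _ fun t _ => hu t
    _ = _ := by simp

/-- coarse label -/
def coarseL (a : ℝ) (x : EuclideanSpace ℝ (Fin 3)) : Fin 3 → ℤ := fun m => ⌊x m / a⌋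

lemma aux_exists_fine (N : ℕ) (hN : 0 < N) (t : ℝ) :
    ∃ k : Fin N, (k:ℝ) ≤ N * Int.fract t ∧ N * Int.fract t < k + 1 := by
  have hN' : (0:ℝ) < N := by exact_mod_cast hN
  have h0 : 0 ≤ N * Int.fract t := mul_nonneg hN'.le (Int.fract_nonneg t)
  have h1 : N * Int.fract t < N := by
    have := mul_lt_mul_of_pos_left (Int.fract_lt_one t) hN'
    simpa using this
  exact ⟨⟨⌊N * Int.fract t⌋₊, (Nat.floor_lt h0).2 h1⟩, Nat.floor_le h0, Nat.lt_floor_add_one _⟩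

lemma aux_coord (x : EuclideanSpace ℝ (Fin 3)) (m : Fin 3) : |x m| ≤ ‖x‖ := by
  simpa using PiLp.norm_apply_le x m

lemma aux_norm (x : EuclideanSpace ℝ (Fin 3)) (c : ℝ) (hc : 0 ≤ c) (h : ∀ m, |x m| ≤ c) :
    ‖x‖ ≤ 2 * c := by
  rw [EuclideanSpace.norm_eq]
  apply Real.sqrt_le_iff.2 ⟨by positivity, ?_⟩
  have : ∀ m, ‖x m‖ ^ 2 ≤ c ^ 2 := fun m => by
    rw [Real.norm_eq_abs]
    exact pow_le_pow_left₀ (abs_nonneg _) (h m) 2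
  calc ∑ m, ‖x m‖ ^ 2 ≤ ∑ m : Fin 3, c ^ 2 := Finset.sum_le_sum fun m _ => this m
    _ ≤ (2 * c) ^ 2 := by simp; nlinarith [sq_nonneg c]

/-- A Lennard-Jones type potential in `ℝ³` (repulsive core `V(x) ≥ C₁/|x|^{3+ε}` for
`0 < |x| ≤ a` and tail bound `|V(x)| ≤ C₂/|x|^{3+ε}` for `|x| > a`) is stable: there is
`B ≥ 0` with `∑_{i<j} V(x_i - x_j) ≥ -B n` for all `n ≥ 2` and pairwise distinct points. -/
theorem statement2 (V : EuclideanSpace ℝ (Fin 3) → ℝ) (hVmeas : Measurable V)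
    (hVsymm : ∀ x : EuclideanSpace ℝ (Fin 3), x ≠ 0 → V (-x) = V x)
    (a C₁ C₂ ε : ℝ) (ha : 0 < a) (hC₁ : 0 < C₁) (hC₂ : 0 < C₂) (hε : 0 < ε)
    (hcore : ∀ x : EuclideanSpace ℝ (Fin 3), x ≠ 0 → ‖x‖ ≤ a →
      C₁ / ‖x‖ ^ (3 + ε) ≤ V x)
    (htail : ∀ x : EuclideanSpace ℝ (Fin 3), a < ‖x‖ →
      |V x| ≤ C₂ / ‖x‖ ^ (3 + ε)) :
    ∃ B : ℝ, 0 ≤ B ∧ ∀ (n : ℕ), 2 ≤ n → ∀ x : Fin n → EuclideanSpace ℝ (Fin 3),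
      Function.Injective x → -(B * n) ≤ pairEnergy V x := by
  set s : ℝ := 1 + ε / 3 with hs
  set u : ℤ → ℝ := fun t => (a / 3 * (1 + |(t:ℝ)|)) ^ (-s) with hu
  have hu0 : ∀ t, 0 ≤ u t := fun t => by positivity
  have husum : Summable u := aux_summable (a / 3) s (by positivity) (by rw [hs]; linarith)
  have hueven : ∀ t, u (-t) = u t := fun t => by simp [hu]
  set w : (Fin 3 → ℤ) → (Fin 3 → ℤ) → ℝ := fun p q => C₂ * ∏ m, u (p m - q m) with hw
  have hw0 : ∀ p q, 0 ≤ w p q := fun p q =>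
    mul_nonneg hC₂.le (Finset.prod_nonneg fun m _ => hu0 _)
  have hwsymm : ∀ p q, w p q = w q p := fun p q => by
    simp only [hw]
    congr 1
    refine Finset.prod_congr rfl fun m _ => ?_
    rw [← hueven, neg_sub]
  set W : ℝ := C₂ * (∑' t, u t) ^ 3 with hWdef
  have hW : ∀ p (T : Finset (Fin 3 → ℤ)), ∑ q ∈ T, w p q ≤ W := fun p T => by
    simp only [hw, ← Finset.mul_sum]
    exact mul_le_mul_of_nonneg_left (aux_w_bound u hu0 husum p T) hC₂.le
  have hW0 : 0 ≤ W := by simpa using hW 0 ∅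
  -- choice of the mesh
  obtain ⟨N, hN2, hNW⟩ : ∃ N : ℕ, 2 ≤ N ∧ W * (2 * a) ^ (3 + ε) / C₁ ≤ (N:ℝ) ^ ε := by
    have h := (tendsto_rpow_atTop hε).comp (tendsto_natCast_atTop_atTop (R := ℝ))
    obtain ⟨N, h1, h2⟩ := ((Filter.eventually_ge_atTop 2).and
      (h.eventually_ge_atTop (W * (2 * a) ^ (3 + ε) / C₁))).exists
    exact ⟨N, h1, h2⟩
  have hNpos : (0:ℝ) < N := by
    have : 0 < N := by omega
    exact_mod_cast this
  have hN2' : (2:ℝ) ≤ N := by exact_mod_cast hN2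
  set A : ℝ := C₁ / (2 * (a / N)) ^ (3 + ε) with hA
  have hA0 : 0 < A := by positivity
  have hAW : W * (N:ℝ) ^ 3 ≤ A := by
    have e1 : 2 * (a / N) = (2 * a) / N := by ring
    rw [hA, e1, Real.div_rpow (by positivity) hNpos.le, div_div_eq_mul_div,
      Real.rpow_add hNpos, le_div_iff₀ (by positivity)]
    rw [div_le_iff₀ hC₁] at hNW
    have e3 : (N:ℝ) ^ (3:ℝ) = (N:ℝ) ^ 3 := by
      exact_mod_cast Real.rpow_natCast (N:ℝ) 3
    rw [e3]
    have := mul_le_mul_of_nonneg_left hNW (pow_nonneg hNpos.le 3)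
    linarith
  choose fl hfl1 hfl2 using aux_exists_fine N (by omega)
  refine ⟨A, hA0.le, fun n hn x hx => ?_⟩
  set Q : Fin n → (Fin 3 → ℤ) := fun i => coarseL a (x i) with hQ
  set r : Fin n → (Fin 3 → Fin N) := fun i m => fl (x i m / a) with hr
  set g : Fin n → Fin n → ℝ := fun i j =>
    A * (if Q i = Q j ∧ r i = r j then (1:ℝ) else 0) - w (Q i) (Q j) with hg
  have hgsymm : ∀ i j, g i j = g j i := fun i j => by
    simp only [hg]
    rw [hwsymm]
    simp only [eq_comm]
  have hpt : ∀ i j, i ≠ j → g i j ≤ V (x i - x j) := by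
    intro i j hij
    have hne : x i - x j ≠ 0 := sub_ne_zero.2 fun h => hij (hx h)
    have hnorm : 0 < ‖x i - x j‖ := norm_pos_iff.2 hne
    by_cases hsame : Q i = Q j ∧ r i = r j
    · have hco : ∀ m, |(x i - x j) m| ≤ a / N := by
        intro m
        have hq : ⌊x i m / a⌋ = ⌊x j m / a⌋ := congrFun hsame.1 m
        have hrr : fl (x i m / a) = fl (x j m / a) := congrFun hsame.2 m
        have hi1 := hfl1 (x i m / a)
        have hi2 := hfl2 (x i m / a)
        have hj1 := hfl1 (x j m / a)
        have hj2 := hfl2 (x j m / a)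
        rw [hrr] at hi1 hi2
        unfold Int.fract at hi1 hi2 hj1 hj2
        rw [hq] at hi1 hi2
        have e : (x i - x j) m = (a / N) * (N * (x i m / a - x j m / a)) := by
          simp only [PiLp.sub_apply]
          field_simp
        rw [e, abs_mul, abs_of_pos (by positivity : 0 < a / N)]
        have : |N * (x i m / a - x j m / a)| ≤ 1 := by
          rw [abs_le]
          constructor <;> linarith
        exact mul_le_of_le_one_right (by positivity) this
      have hle := aux_norm (x i - x j) (a / N) (by positivity) hco
      have hlea : ‖x i - x j‖ ≤ a := by
        refine hle.trans ?_
        rw [← mul_div_assoc, div_le_iff₀ hNpos]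
        nlinarith
      have h1 := hcore _ hne hlea
      have h2 : A ≤ C₁ / ‖x i - x j‖ ^ (3 + ε) := by
        rw [hA]
        have := Real.rpow_le_rpow hnorm.le hle (by linarith : (0:ℝ) ≤ 3 + ε)
        gcongr
      simp only [hg, if_pos hsame]
      linarith [hw0 (Q i) (Q j)]
    · simp only [hg, if_neg hsame]
      by_cases hlea : ‖x i - x j‖ ≤ a
      · have h1 := hcore _ hne hlea
        have h2 : 0 ≤ C₁ / ‖x i - x j‖ ^ (3 + ε) := by positivity
        linarith [hw0 (Q i) (Q j)]
      · push Not at hlea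
        have h1 := (abs_le.1 (htail _ hlea)).1
        have hm : ∀ m, ‖x i - x j‖ ^ (-s) ≤ u (Q i m - Q j m) := by
          intro m
          refine Real.rpow_le_rpow_of_nonpos (by positivity) ?_ (by rw [hs]; linarith)
          have hc := aux_coord (x i - x j) m
          have e : (x i - x j) m = x i m - x j m := rfl
          rw [e] at hc
          have f1 := Int.floor_le (x i m / a)
          have f2 := Int.lt_floor_add_one (x i m / a)
          have f3 := Int.floor_le (x j m / a)
          have f4 := Int.lt_floor_add_one (x j m / a)
          rw [abs_le] at hc
          have d1 : x i m / a - x j m / a ≤ ‖x i - x j‖ / a := by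
            rw [← sub_div]; exact div_le_div_of_nonneg_right hc.2 ha.le
          have d2 : -(‖x i - x j‖ / a) ≤ x i m / a - x j m / a := by
            rw [← sub_div, ← neg_div]; exact div_le_div_of_nonneg_right hc.1 ha.le
          have d3 : 1 ≤ ‖x i - x j‖ / a := by
            rw [le_div_iff₀ ha]; linarith
          have d4 : |((Q i m - Q j m : ℤ) : ℝ)| ≤ ‖x i - x j‖ / a + 1 := by
            push_cast
            simp only [hQ, coarseL]
            rw [abs_le]
            constructor <;> linarith
          have d5 : 1 + |((Q i m - Q j m : ℤ) : ℝ)| ≤ 3 * (‖x i - x j‖ / a) := by linarith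
          calc a / 3 * (1 + |((Q i m - Q j m : ℤ) : ℝ)|)
              ≤ a / 3 * (3 * (‖x i - x j‖ / a)) := by gcongr
            _ = ‖x i - x j‖ := by field_simp
        have h2 : C₂ / ‖x i - x j‖ ^ (3 + ε) ≤ w (Q i) (Q j) := by
          have e : C₂ / ‖x i - x j‖ ^ (3 + ε) = C₂ * ∏ m : Fin 3, ‖x i - x j‖ ^ (-s) := by
            rw [Finset.prod_const, Finset.card_univ, Fintype.card_fin, ← Real.rpow_natCast,
              ← Real.rpow_mul hnorm.le, div_eq_mul_inv, ← Real.rpow_neg hnorm.le]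
            congr 2
            rw [hs]; push_cast; ring
          rw [e]
          simp only [hw]
          exact mul_le_mul_of_nonneg_left
            (Finset.prod_le_prod (fun m _ => by positivity) fun m _ => hm m) hC₂.le
        linarith
  have hE : ∑ p ∈ Finset.univ.filter (fun p : Fin n × Fin n => p.1 < p.2), g p.1 p.2
      ≤ pairEnergy V x := by
    unfold pairEnergy
    refine Finset.sum_le_sum fun p hp => hpt _ _ ?_
    exact (Finset.mem_filter.1 hp).2.ne
  have hpairs := aux_pairs g hgsymm
  have hdiag : ∑ i, g i i ≤ A * n := by
    calc ∑ i, g i i ≤ ∑ i : Fin n, A := by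
          refine Finset.sum_le_sum fun i _ => ?_
          simp only [hg]
          simp
          exact hw0 _ _
      _ = A * n := by simp [mul_comm]
  have hdbl : 0 ≤ ∑ i, ∑ j, g i j := by
    have h1 := aux_schur Q w W hw0 hwsymm hW
    have h2 := aux_fine Q r
    set F := ∑ i, ∑ j, (if Q i = Q j ∧ r i = r j then (1:ℝ) else 0) with hF
    have hF0 : 0 ≤ F := Finset.sum_nonneg fun i _ => Finset.sum_nonneg fun j _ => by
      split_ifs <;> norm_num
    have e : ∑ i, ∑ j, g i j = A * F - ∑ i, ∑ j, w (Q i) (Q j) := by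
      simp only [hg, Finset.sum_sub_distrib, ← Finset.mul_sum, hF]
    have hcard : (Fintype.card (Fin 3 → Fin N) : ℝ) = (N:ℝ) ^ 3 := by simp
    rw [hcard] at h2
    have h2' := h2.trans (le_of_eq (b := (N:ℝ) ^ 3 * F) (by rw [hF]; congr!))
    have h3 := mul_le_mul_of_nonneg_left h2' hW0
    have h4 := mul_le_mul_of_nonneg_right hAW hF0
    rw [e]
    linarith
  have hAn : 0 ≤ A * n := by positivity
  linarith

end
end

section
/- Let n ≥ 1 and let w_{ij} be real numbers indexed by the unordered pairs {i,j} ⊆ {1, …, n}. For a finite nonempty set I ⊆ {1, …, n}, let Φ(I) = ∑ over connected simple graphs g with vertex set I of ∏_{{i,j}∈E_g} w_{ij}, with the convention Φ(I) = 1 when |I| = 1. Then ∏_{1≤i<j≤n} (1 + w_{ij}) = ∑_{k=1}^{n} ∑_{{I_1, …, I_k} a partition of {1, …, n} into k nonempty blocks} ∏_{j=1}^{k} Φ(I_j). -/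
open scoped BigOperators

noncomputable section
open Classical

/-- The edges of a simple graph on a linearly ordered vertex type, listed as ordered pairs
`(i, j)` with `i < j` (each unordered edge `{i,j}` appears exactly once). -/
def edgePairs {α : Type*} [Fintype α] [LinearOrder α] (g : SimpleGraph α) :
    Finset (α × α) :=
  Finset.univ.filter fun p => p.1 < p.2 ∧ g.Adj p.1 p.2

/-- `connSum w I = Φ(I)`: the sum, over all connected simple graphs `g` with vertex set
`I`, of `∏_{{i,j} ∈ E_g} w_{ij}` (for a singleton `I` this equals `1`, the contribution
of the one-vertex graph). -/
def connSum {n : ℕ} (w : Sym2 (Fin n) → ℝ) (I : Finset (Fin n)) : ℝ :=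
  ∑ g ∈ (Finset.univ : Finset (SimpleGraph ↥I)).filter (fun g => g.Connected),
    ∏ p ∈ edgePairs g, w s((p.1 : Fin n), (p.2 : Fin n))

/-- The partition conditions (without the number of blocks). -/
def IsPart {n : ℕ} (P : Finset (Finset (Fin n))) : Prop :=
  (∀ I ∈ P, I.Nonempty) ∧ ((P : Set (Finset (Fin n))).PairwiseDisjoint id) ∧
    P.biUnion id = Finset.univ

/-- `g` splits along `P` into connected pieces. -/
def Good {n : ℕ} (g : SimpleGraph (Fin n)) (P : Finset (Finset (Fin n))) : Prop :=
  (∀ I ∈ P, (g.comap (Subtype.val : ↥I → Fin n)).Connected) ∧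
    ∀ a b, g.Adj a b → ∃ I ∈ P, a ∈ I ∧ b ∈ I

/-- The component of `a`. -/
def compOf {n : ℕ} (g : SimpleGraph (Fin n)) (a : Fin n) : Finset (Fin n) :=
  Finset.univ.filter fun b => g.Reachable a b

/-- Weight of a graph. -/
def wt {n : ℕ} (w : Sym2 (Fin n) → ℝ) (g : SimpleGraph (Fin n)) : ℝ :=
  ∏ p ∈ edgePairs g, w s(p.1, p.2)

theorem IsPart.eq_of_mem {n : ℕ} {P : Finset (Finset (Fin n))} (hP : IsPart P)
    {I J : Finset (Fin n)} (hI : I ∈ P) (hJ : J ∈ P) {a : Fin n} (ha : a ∈ I) (hb : a ∈ J) :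
    I = J := by
  by_contra h
  exact Finset.disjoint_left.1 (hP.2.1 hI hJ h) ha hb

theorem IsPart.exists_mem {n : ℕ} {P : Finset (Finset (Fin n))} (hP : IsPart P) (a : Fin n) :
    ∃ I ∈ P, a ∈ I := by
  have : a ∈ P.biUnion id := by rw [hP.2.2]; exact Finset.mem_univ a
  simpa using this

theorem good_block {n : ℕ} {g : SimpleGraph (Fin n)} {P : Finset (Finset (Fin n))}
    (hP : IsPart P) (hg : Good g P) {I : Finset (Fin n)} (hI : I ∈ P) {a : Fin n} (ha : a ∈ I) :
    I = compOf g a := by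
  ext b
  simp only [compOf, Finset.mem_filter, Finset.mem_univ, true_and]
  constructor
  · intro hb
    have h := (hg.1 I hI).preconnected ⟨a, ha⟩ ⟨b, hb⟩
    exact h.map (SimpleGraph.Hom.comap Subtype.val g)
  · rintro ⟨p⟩
    induction p with
    | nil => exact ha
    | cons h p ih =>
      apply ih
      obtain ⟨J, hJ, h1, h2⟩ := hg.2 _ _ h
      rw [hP.eq_of_mem hI hJ ha h1]
      exact h2

theorem good_iff {n : ℕ} (g : SimpleGraph (Fin n)) (P : Finset (Finset (Fin n))) :
    (IsPart P ∧ Good g P) ↔ P = Finset.univ.image (compOf g) := by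
  constructor
  · rintro ⟨hP, hg⟩
    ext I
    simp only [Finset.mem_image, Finset.mem_univ, true_and]
    constructor
    · intro hI
      obtain ⟨a, ha⟩ := hP.1 I hI
      exact ⟨a, (good_block hP hg hI ha).symm⟩
    · rintro ⟨a, rfl⟩
      obtain ⟨I, hI, ha⟩ := hP.exists_mem a
      rw [← good_block hP hg hI ha]
      exact hI
  · rintro rfl
    refine ⟨⟨?_, ?_, ?_⟩, ?_, ?_⟩
    · intro I hI
      obtain ⟨a, -, rfl⟩ := Finset.mem_image.1 hI
      exact ⟨a, by simp [compOf]⟩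
    · intro I hI J hJ hIJ
      simp only [Finset.coe_image, Finset.coe_univ, Set.image_univ, Set.mem_range] at hI hJ
      obtain ⟨a, rfl⟩ := hI
      obtain ⟨b, rfl⟩ := hJ
      simp only [Function.onFun, id]
      rw [Finset.disjoint_left]
      intro c hc hd
      apply hIJ
      simp only [compOf, Finset.mem_filter, Finset.mem_univ, true_and] at hc hd
      have hab := hc.trans hd.symm
      ext x
      simp only [compOf, Finset.mem_filter, Finset.mem_univ, true_and]
      exact ⟨fun h => hab.symm.trans h, fun h => hab.trans h⟩
    · ext a
      simp only [Finset.mem_biUnion, Finset.mem_univ, iff_true]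
      exact ⟨compOf g a, by simp, by simp [compOf]⟩
    · intro I hI
      obtain ⟨a, -, rfl⟩ := Finset.mem_image.1 hI
      have key : ∀ (x b : Fin n) (p : g.Walk x b) (hx : x ∈ compOf g a) (hb : b ∈ compOf g a),
          (g.comap (Subtype.val : ↥(compOf g a) → Fin n)).Reachable ⟨x, hx⟩ ⟨b, hb⟩ := by
        intro x b p
        induction p with
        | nil => intro _ _; exact SimpleGraph.Reachable.refl _
        | @cons u v z h p ih =>
          intro hx hb
          have hv : v ∈ compOf g a := by
            simp only [compOf, Finset.mem_filter, Finset.mem_univ, true_and] at hx ⊢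
            exact hx.trans h.reachable
          refine SimpleGraph.Reachable.trans ?_ (ih hv hb)
          apply SimpleGraph.Adj.reachable
          exact h
      have hne : Nonempty ↥(compOf g a) := ⟨⟨a, by simp [compOf]⟩⟩
      refine ⟨?_⟩
      rintro ⟨x, hx⟩ ⟨b, hb⟩
      have h1 := hx
      have h2 := hb
      simp only [compOf, Finset.mem_filter, Finset.mem_univ, true_and] at h1 h2
      obtain ⟨p⟩ := h1.symm.trans h2
      exact key x b p hx hb
    · intro a b hab
      exact ⟨compOf g a, by simp, by simp [compOf], by simpa [compOf] using hab.reachable⟩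

/-- Weight factorization. -/
theorem wt_factor {n : ℕ} (w : Sym2 (Fin n) → ℝ) {g : SimpleGraph (Fin n)}
    {P : Finset (Finset (Fin n))} (hP : IsPart P) (hg : Good g P) :
    wt w g = ∏ I ∈ P.attach, ∏ p ∈ edgePairs (g.comap (Subtype.val : ↥I.1 → Fin n)),
      w s((p.1 : Fin n), (p.2 : Fin n)) := by
  rw [Finset.prod_sigma', wt]
  symm
  refine Finset.prod_bij (fun x _ => ((x.2.1 : Fin n), (x.2.2 : Fin n))) ?_ ?_ ?_ ?_
  · rintro ⟨⟨I, hI⟩, ⟨a, ha⟩, ⟨b, hb⟩⟩ h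
    simpa [edgePairs] using h
  · rintro ⟨⟨I, hI⟩, ⟨a, ha⟩, ⟨b, hb⟩⟩ h ⟨⟨J, hJ⟩, ⟨c, hc⟩, ⟨d, hd⟩⟩ h' heq
    simp only [Prod.mk.injEq] at heq
    obtain ⟨rfl, rfl⟩ := heq
    obtain rfl := hP.eq_of_mem hI hJ ha hc
    rfl
  · rintro ⟨a, b⟩ h
    simp only [edgePairs, Finset.mem_filter, Finset.mem_univ, true_and] at h
    obtain ⟨I, hI, ha, hb⟩ := hg.2 _ _ h.2
    exact ⟨⟨⟨I, hI⟩, ⟨a, ha⟩, ⟨b, hb⟩⟩, by simpa [edgePairs] using h, rfl⟩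
  · intro x _
    rfl

/-- Gluing of graphs on the blocks. -/
def glue {n : ℕ} {P : Finset (Finset (Fin n))}
    (h : ∀ I ∈ P, SimpleGraph ↥I) : SimpleGraph (Fin n) where
  Adj a b := ∃ (I : Finset (Fin n)) (hI : I ∈ P) (ha : a ∈ I) (hb : b ∈ I),
    (h I hI).Adj ⟨a, ha⟩ ⟨b, hb⟩
  symm := ⟨by
    rintro a b ⟨I, hI, ha, hb, hh⟩
    exact ⟨I, hI, hb, ha, hh.symm⟩⟩
  loopless := ⟨by
    rintro a ⟨I, hI, ha, hb, hh⟩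
    exact hh.ne rfl⟩

theorem glue_comap {n : ℕ} {P : Finset (Finset (Fin n))} (hP : IsPart P)
    (h : ∀ I ∈ P, SimpleGraph ↥I) (I : Finset (Fin n)) (hI : I ∈ P) :
    (glue h).comap (Subtype.val : ↥I → Fin n) = h I hI := by
  ext ⟨a, ha⟩ ⟨b, hb⟩
  constructor
  · rintro ⟨J, hJ, ha', hb', hh⟩
    obtain rfl := hP.eq_of_mem hI hJ ha ha'
    exact hh
  · intro hh
    exact ⟨I, hI, ha, hb, hh⟩

theorem sum_good {n : ℕ} (w : Sym2 (Fin n) → ℝ) {P : Finset (Finset (Fin n))} (hP : IsPart P) :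
    ∑ g ∈ (Finset.univ : Finset (SimpleGraph (Fin n))).filter (fun g => Good g P), wt w g =
      ∏ I ∈ P, connSum w I := by
  unfold connSum
  rw [Finset.prod_sum]
  refine Finset.sum_bij (fun g _ I _ => g.comap (Subtype.val : ↥I → Fin n)) ?_ ?_ ?_ ?_
  · intro g hg
    simp only [Finset.mem_filter, Finset.mem_univ, true_and] at hg
    simp only [Finset.mem_pi, Finset.mem_filter, Finset.mem_univ, true_and]
    exact hg.1
  · intro g hg g' hg' heq
    simp only [Finset.mem_filter, Finset.mem_univ, true_and] at hg hg'
    ext a b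
    constructor
    · intro hab
      obtain ⟨I, hI, ha, hb⟩ := hg.2 _ _ hab
      have h1 := congrFun (congrFun heq I) hI
      have h2 : (g.comap (Subtype.val : ↥I → Fin n)).Adj ⟨a, ha⟩ ⟨b, hb⟩ := hab
      rw [h1] at h2
      exact h2
    · intro hab
      obtain ⟨I, hI, ha, hb⟩ := hg'.2 _ _ hab
      have h1 := congrFun (congrFun heq I) hI
      have h2 : (g'.comap (Subtype.val : ↥I → Fin n)).Adj ⟨a, ha⟩ ⟨b, hb⟩ := hab
      rw [← h1] at h2
      exact h2
  · intro h hh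
    simp only [Finset.mem_pi, Finset.mem_filter, Finset.mem_univ, true_and] at hh
    refine ⟨glue h, ?_, ?_⟩
    · simp only [Finset.mem_filter, Finset.mem_univ, true_and]
      refine ⟨fun I hI => ?_, ?_⟩
      · rw [glue_comap hP h I hI]
        exact hh I hI
      · rintro a b ⟨I, hI, ha, hb, -⟩
        exact ⟨I, hI, ha, hb⟩
    · funext I hI
      exact glue_comap hP h I hI
  · intro g hg
    simp only [Finset.mem_filter, Finset.mem_univ, true_and] at hg
    exact wt_factor w hP hg

theorem prod_eq_sum_wt {n : ℕ} (w : Sym2 (Fin n) → ℝ) :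
    (∏ p ∈ Finset.univ.filter (fun p : Fin n × Fin n => p.1 < p.2), (1 + w s(p.1, p.2))) =
      ∑ g : SimpleGraph (Fin n), wt w g := by
  rw [Finset.prod_one_add]
  symm
  refine Finset.sum_bij (fun g _ => edgePairs g) ?_ ?_ ?_ ?_
  · intro g _
    rw [Finset.mem_powerset]
    intro p hp
    simp only [edgePairs, Finset.mem_filter, Finset.mem_univ, true_and] at hp ⊢
    exact hp.1
  · intro g _ g' _ h
    have key : ∀ a b, a < b → (g.Adj a b ↔ g'.Adj a b) := by
      intro a b hab
      have := Finset.ext_iff.1 h (a, b)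
      simpa [edgePairs, hab] using this
    ext a b
    rcases lt_trichotomy a b with hab | rfl | hab
    · exact key a b hab
    · simp
    · rw [g.adj_comm, g'.adj_comm]
      exact key b a hab
  · intro t ht
    rw [Finset.mem_powerset] at ht
    refine ⟨SimpleGraph.fromRel (fun a b => (a, b) ∈ t), Finset.mem_univ _, ?_⟩
    have hlt : ∀ a b, (a, b) ∈ t → a < b := by
      intro a b hab
      simpa using ht hab
    ext ⟨a, b⟩
    simp only [edgePairs, Finset.mem_filter, Finset.mem_univ, true_and, SimpleGraph.fromRel_adj]
    constructor
    · rintro ⟨h1, -, h2 | h2⟩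
      · exact h2
      · exact absurd (hlt _ _ h2) h1.asymm
    · intro h
      exact ⟨hlt _ _ h, (hlt _ _ h).ne, Or.inl h⟩
  · intro g _
    rfl

theorem IsPart.card_le {n : ℕ} {P : Finset (Finset (Fin n))} (hP : IsPart P) : P.card ≤ n := by
  have h := Finset.card_biUnion (s := P) (t := id) (fun x hx y hy hxy => hP.2.1 hx hy hxy)
  rw [hP.2.2, Finset.card_univ, Fintype.card_fin] at h
  refine le_trans ?_ h.symm.le
  rw [Finset.card_eq_sum_ones]
  exact Finset.sum_le_sum fun I hI => Finset.card_pos.2 (hP.1 I hI)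

theorem sum_part {n : ℕ} (w : Sym2 (Fin n) → ℝ) :
    ∑ g : SimpleGraph (Fin n), wt w g =
      ∑ P ∈ (Finset.univ : Finset (Finset (Finset (Fin n)))).filter (fun P => IsPart P),
        ∏ I ∈ P, connSum w I := by
  have h1 : ∀ P ∈ (Finset.univ : Finset (Finset (Finset (Fin n)))).filter (fun P => IsPart P),
      ∏ I ∈ P, connSum w I =
        ∑ g : SimpleGraph (Fin n), if Good g P then wt w g else 0 := by
    intro P hP
    rw [← sum_good w (Finset.mem_filter.1 hP).2, Finset.sum_filter]
  rw [Finset.sum_congr rfl h1, Finset.sum_comm]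
  refine Finset.sum_congr rfl fun g _ => ?_
  rw [← Finset.sum_filter, Finset.filter_filter]
  simp only [good_iff]
  simp [Finset.filter_eq']

/-- `∏_{1≤i<j≤n} (1 + w_{ij}) = ∑_{k=1}^n ∑_{{I_1,…,I_k} partition of {1,…,n}} ∏_j Φ(I_j)`,
where a partition into `k` blocks is a family of `k` pairwise disjoint nonempty subsets
covering `{1,…,n}`. -/
theorem statement5 (n : ℕ) (hn : 1 ≤ n) (w : Sym2 (Fin n) → ℝ) :
    (∏ p ∈ Finset.univ.filter (fun p : Fin n × Fin n => p.1 < p.2), (1 + w s(p.1, p.2))) =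
      ∑ k ∈ Finset.Icc 1 n,
        ∑ P ∈ (Finset.univ : Finset (Finset (Finset (Fin n)))).filter
            (fun P : Finset (Finset (Fin n)) => P.card = k ∧ (∀ I ∈ P, I.Nonempty) ∧
              ((P : Set (Finset (Fin n))).PairwiseDisjoint id) ∧
              P.biUnion id = Finset.univ),
          ∏ I ∈ P, connSum w I := by
  rw [prod_eq_sum_wt, sum_part]
  rw [← Finset.sum_fiberwise_of_maps_to (t := Finset.Icc 1 n) (g := Finset.card)]
  · refine Finset.sum_congr rfl fun k _ => Finset.sum_congr ?_ fun _ _ => rfl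
    ext P
    simp only [Finset.mem_filter, Finset.mem_univ, true_and]
    unfold IsPart
    tauto
  · intro P hP
    have hP := (Finset.mem_filter.1 hP).2
    obtain ⟨I, hI, -⟩ := hP.exists_mem ⟨0, hn⟩
    exact Finset.mem_Icc.2 ⟨Finset.card_pos.2 ⟨I, hI⟩, hP.card_le⟩

end
end

section
/- Let V be a pair potential in dimension d and β > 0 with C(β) = ∫_{ℝ^d} |e^{−βV(x)} − 1| dx < ∞, let Λ ⊂ ℝ^d be measurable with finite volume |Λ|, let n ≥ 2, and let τ be a tree on {1, …, n} with edge set E_τ. Then ∫_{Λ^n} ∏_{{i,j}∈E_τ} |e^{−βV(x_i − x_j)} − 1| dx_1⋯dx_n ≤ |Λ| · C(β)^{n−1}. -/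
open MeasureTheory
open scoped BigOperators

noncomputable section
open Classical

theorem edgePairs_prod_eq {n : ℕ} {M : Type*} [CommMonoid M] (τ : SimpleGraph (Fin n))
    (g : Fin n → Fin n → M) :
    ∏ p ∈ edgePairs τ, g p.1 p.2 =
      ∏ i, ∏ j, if i < j ∧ τ.Adj i j then g i j else 1 := by
  rw [edgePairs, Finset.prod_filter, ← Finset.univ_product_univ, Finset.prod_product]

theorem edgePairs_prod_leaf {n : ℕ} {M : Type*} [CommMonoid M] (τ : SimpleGraph (Fin (n + 1)))
    (v : Fin (n + 1)) (w : Fin n) (hw : ∀ j, τ.Adj v (v.succAbove j) ↔ j = w)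
    (g : Fin (n + 1) → Fin (n + 1) → M) (hg : ∀ i j, g i j = g j i) :
    ∏ p ∈ edgePairs τ, g p.1 p.2 =
      g v (v.succAbove w) * ∏ p ∈ edgePairs (τ.comap v.succAbove),
        g (v.succAbove p.1) (v.succAbove p.2) := by
  rw [edgePairs_prod_eq,
    edgePairs_prod_eq (τ.comap v.succAbove) (fun i j => g (v.succAbove i) (v.succAbove j)),
    Fin.prod_univ_succAbove _ v]
  simp_rw [Fin.prod_univ_succAbove _ v]
  rw [Finset.prod_mul_distrib, ← mul_assoc]
  congr 1
  · simp only [lt_self_iff_false, false_and, if_false, one_mul]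
    rw [← Finset.prod_mul_distrib, Finset.prod_eq_single w]
    · have h1 : τ.Adj v (v.succAbove w) := (hw w).2 rfl
      rcases lt_or_gt_of_ne h1.ne with h | h
      · simp [h, h.not_gt, h1]
      · simp [h, h.not_gt, h1.symm, hg]
    · intro b _ hb
      have h1 : ¬ τ.Adj v (v.succAbove b) := fun h => hb ((hw b).1 h)
      have h2 : ¬ τ.Adj (v.succAbove b) v := fun h => h1 h.symm
      simp [h1, h2]
    · simp
  · simp

theorem exists_leaf {n : ℕ} (τ : SimpleGraph (Fin (n + 2))) (hτ : τ.IsTree) :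
    ∃ (v : Fin (n + 2)) (w : Fin (n + 1)), (∀ j, τ.Adj v (v.succAbove j) ↔ j = w) ∧
      (τ.comap v.succAbove).IsTree := by
  obtain ⟨v, hv⟩ := hτ.exists_vert_degree_one_of_nontrivial
  have hc := hτ.1.induce_compl_singleton_of_degree_eq_one hv
  obtain ⟨u, hu, huu⟩ := SimpleGraph.degree_eq_one_iff_existsUnique_adj.mp hv
  obtain ⟨w, rfl⟩ := Fin.exists_succAbove_eq hu.ne'
  refine ⟨v, w, fun j => ⟨fun h => Fin.succAbove_right_injective (huu _ h), fun h => h ▸ hu⟩, ?_, ?_⟩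
  · let e : τ.comap v.succAbove ≃g τ.induce ({v}ᶜ : Set (Fin (n + 2))) :=
      { toEquiv := finSuccAboveEquiv v
        map_rel_iff' := by intro a b; exact Iff.rfl }
    exact e.connected_iff.2 hc
  · exact hτ.2.of_comap (Fin.succAboveEmb v)

theorem tree_lintegral_le {E : Type*} [AddCommGroup E] [MeasurableSpace E] [MeasurableSub₂ E]
    [MeasurableAdd₂ E] [MeasurableNeg E]
    (μ ν : Measure E) [SigmaFinite μ] [ν.IsAddRightInvariant] (hμν : μ ≤ ν)
    (f : E → ENNReal) (hf : Measurable f) (hs : ∀ x, f (-x) = f x)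
    (n : ℕ) (τ : SimpleGraph (Fin (n + 1))) (hτ : τ.IsTree) :
    ∫⁻ x, ∏ p ∈ edgePairs τ, f (x p.1 - x p.2) ∂(Measure.pi fun _ : Fin (n + 1) => μ)
      ≤ μ Set.univ * (∫⁻ y, f y ∂ν) ^ n := by
  induction n with
  | zero =>
    have : edgePairs τ = ∅ := by
      ext p
      have h : p.1 = p.2 := Fin.ext (by omega)
      simp [edgePairs, h]
    simp [this, Measure.pi_univ]
  | succ n ih =>
    obtain ⟨v, w, hw, ht⟩ := exists_leaf τ hτ
    have key : ∀ x : Fin (n + 2) → E, ∏ p ∈ edgePairs τ, f (x p.1 - x p.2) =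
        f (x v - x (v.succAbove w)) * ∏ p ∈ edgePairs (τ.comap v.succAbove),
          f (x (v.succAbove p.1) - x (v.succAbove p.2)) := fun x =>
      edgePairs_prod_leaf τ v w hw (fun i j => f (x i - x j))
        (fun i j => by rw [← hs, neg_sub])
    have hmp := measurePreserving_piFinSuccAbove (fun _ : Fin (n + 2) => μ) v
    have hm : Measurable (fun z : E × (Fin (n + 1) → E) => f (z.1 - z.2 w) *
        ∏ p ∈ edgePairs (τ.comap v.succAbove), f (z.2 p.1 - z.2 p.2)) := by
      refine Measurable.mul (by fun_prop) (Finset.measurable_prod _ fun p _ => by fun_prop)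
    have h1 := hmp.lintegral_comp hm
    have h2 : ∫⁻ x, ∏ p ∈ edgePairs τ, f (x p.1 - x p.2)
          ∂(Measure.pi fun _ : Fin (n + 2) => μ) =
        ∫⁻ z : E × (Fin (n + 1) → E), f (z.1 - z.2 w) *
          ∏ p ∈ edgePairs (τ.comap v.succAbove), f (z.2 p.1 - z.2 p.2)
          ∂(μ.prod (Measure.pi fun _ : Fin (n + 1) => μ)) := by
      rw [← h1]
      exact lintegral_congr fun x => key x
    rw [h2, lintegral_prod_symm' _ hm]
    calc _ ≤ ∫⁻ y : Fin (n + 1) → E, (∫⁻ a, f a ∂ν) *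
          ∏ p ∈ edgePairs (τ.comap v.succAbove), f (y p.1 - y p.2)
          ∂(Measure.pi fun _ : Fin (n + 1) => μ) := by
          refine lintegral_mono fun y => ?_
          dsimp only
          rw [lintegral_mul_const _ (by fun_prop)]
          refine mul_le_mul_left ?_ _
          refine (lintegral_mono' hμν le_rfl : _ ≤ ∫⁻ a, f (a - y w) ∂ν).trans ?_
          rw [lintegral_sub_right_eq_self]
      _ = (∫⁻ a, f a ∂ν) * ∫⁻ y : Fin (n + 1) → E,
          ∏ p ∈ edgePairs (τ.comap v.succAbove), f (y p.1 - y p.2)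
          ∂(Measure.pi fun _ : Fin (n + 1) => μ) := by
          rw [lintegral_const_mul]
          exact Finset.measurable_prod _ fun p _ => by fun_prop
      _ ≤ (∫⁻ a, f a ∂ν) * (μ Set.univ * (∫⁻ y, f y ∂ν) ^ n) := by
          gcongr
          exact ih _ ht
      _ = _ := by ring

/-- For a tree `τ` on `{1,…,n}`,
`∫_{Λ^n} ∏_{{i,j}∈E_τ} |e^{-βV(x_i-x_j)} - 1| dx ≤ |Λ| · C(β)^{n-1}`, where
`C(β) = ∫_{ℝ^d} |e^{-βV(x)} - 1| dx`. -/
theorem statement6 {d : ℕ} (β : ℝ) (hβ : 0 < β)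
    (V : EuclideanSpace ℝ (Fin d) → ℝ) (hVmeas : Measurable V)
    (hVsymm : ∀ x, V (-x) = V x)
    (hC : Integrable (fun x : EuclideanSpace ℝ (Fin d) => |Real.exp (-(β * V x)) - 1|))
    (Λ : Set (EuclideanSpace ℝ (Fin d))) (hΛmeas : MeasurableSet Λ)
    (hΛvol : volume Λ < ⊤)
    (n : ℕ) (hn : 2 ≤ n) (τ : SimpleGraph (Fin n)) (hτ : τ.IsTree) :
    (∫ x in Set.univ.pi (fun _ : Fin n => Λ),
        ∏ p ∈ edgePairs τ, |Real.exp (-(β * V (x p.1 - x p.2))) - 1|)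
      ≤ (volume Λ).toReal *
        (∫ y : EuclideanSpace ℝ (Fin d), |Real.exp (-(β * V y)) - 1|) ^ (n - 1) := by
  obtain ⟨m, rfl⟩ : ∃ m, n = m + 1 := ⟨n - 1, by omega⟩
  haveI : IsFiniteMeasure (volume.restrict Λ) := ⟨by simpa using hΛvol⟩
  have hmeas : Measurable (fun x : EuclideanSpace ℝ (Fin d) =>
      ENNReal.ofReal |Real.exp (-(β * V x)) - 1|) := by fun_prop
  have main := tree_lintegral_le (volume.restrict Λ) volume Measure.restrict_le_self
    (fun x : EuclideanSpace ℝ (Fin d) => ENNReal.ofReal |Real.exp (-(β * V x)) - 1|) hmeas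
    (fun x => by simp only [hVsymm]) m τ hτ
  rw [integral_eq_lintegral_of_nonneg_ae
      (Filter.Eventually.of_forall fun x => Finset.prod_nonneg fun p _ => abs_nonneg _)
      (Finset.measurable_prod _ fun p _ => by fun_prop).aestronglyMeasurable,
    integral_eq_lintegral_of_nonneg_ae (Filter.Eventually.of_forall fun x => abs_nonneg _)
      (by fun_prop), volume_pi, Measure.restrict_pi_pi, Nat.add_sub_cancel, ← ENNReal.toReal_pow,
    ← ENNReal.toReal_mul]
  refine ENNReal.toReal_mono ?_ ?_
  · refine ENNReal.mul_ne_top hΛvol.ne (ENNReal.pow_ne_top ?_)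
    have := hC.lintegral_lt_top
    exact this.ne
  · rw [Measure.restrict_apply_univ] at main
    refine le_trans (le_of_eq ?_) main
    refine lintegral_congr fun x => ?_
    rw [ENNReal.ofReal_prod_of_nonneg fun p _ => abs_nonneg _]

end
end

section
/- Fix real numbers α > 0 and c > 0, and for integers n ≥ 1, ℓ ≥ 0 define K_{n,ℓ} = α^{n+ℓ−1} · n · (n+ℓ)^{ℓ−1} · c^ℓ / ℓ! (where for ℓ = 0 the factor n·(n)^{−1} is understood as 1), and set K_{0,ℓ} = 0 for all ℓ ≥ 0. Then K_{1,0} = 1 and, for all integers n ≥ 1 and ℓ ≥ 0 with n + ℓ ≥ 2, the Kirkwood–Salsburg recursion holds: K_{n,ℓ} = α ∑_{s=0}^{ℓ} (c^s / s!) K_{n−1+s, ℓ−s}. -/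
open scoped BigOperators

noncomputable section
open Classical

/-- The explicit solution `K_{n,ℓ} = α^{n+ℓ-1} n (n+ℓ)^{ℓ-1} c^ℓ/ℓ!` of the
Kirkwood–Salsburg recursion (the exponent `ℓ-1` is an integer exponent, so that for
`ℓ = 0` the factor `n (n)^{-1}` is `1`), extended by `K_{0,ℓ} = 0`. -/
def KS (α c : ℝ) : ℕ → ℕ → ℝ
  | 0, _ => 0
  | n + 1, ℓ =>
      α ^ (n + ℓ) * ((n : ℝ) + 1) * ((n : ℝ) + 1 + (ℓ : ℝ)) ^ ((ℓ : ℤ) - 1) *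
        c ^ ℓ / (ℓ.factorial : ℝ)

theorem KS_eq (α c : ℝ) (p q : ℕ) : KS α c p q =
    α ^ (p + q - 1) * (p : ℝ) * ((p : ℝ) + q) ^ ((q : ℤ) - 1) * c ^ q / (q.factorial : ℝ) := by
  cases p with
  | zero => simp [KS]
  | succ n =>
    have : n + 1 + q - 1 = n + q := by omega
    rw [this]
    simp [KS]

theorem sum_choose_pow (N : ℝ) (l : ℕ) :
    ∑ s ∈ Finset.range (l + 1), (l.choose s : ℝ) * N ^ (l - s) = (N + 1) ^ l := by
  rw [add_comm N 1, add_pow]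
  refine Finset.sum_congr rfl fun s _ => ?_
  simp [mul_comm]

theorem sum_choose_mul_pow (N : ℝ) (l : ℕ) :
    (∑ s ∈ Finset.range (l + 1), (l.choose s : ℝ) * s * N ^ (l - s)) * (N + 1)
      = l * (N + 1) ^ l := by
  cases l with
  | zero => simp
  | succ k =>
    rw [Finset.sum_range_succ']
    have : ∀ s ∈ Finset.range (k + 1), ((k + 1).choose (s + 1) : ℝ) * ((s + 1 : ℕ) : ℝ)
        * N ^ (k + 1 - (s + 1)) = ((k + 1 : ℕ) : ℝ) * ((k.choose s : ℝ) * N ^ (k - s)) := by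
      intro s _
      have h : ((k + 1 : ℕ) : ℝ) * (k.choose s : ℝ)
          = ((k + 1).choose (s + 1) : ℝ) * ((s + 1 : ℕ) : ℝ) := by
        exact_mod_cast Nat.add_one_mul_choose_eq k s
      rw [← h, Nat.add_sub_add_right]
      ring
    rw [Finset.sum_congr rfl this, ← Finset.mul_sum, sum_choose_pow]
    simp
    ring

theorem key (m l : ℕ) (h : 1 ≤ m + l) :
    ∑ s ∈ Finset.range (l + 1), (l.choose s : ℝ) * ((m : ℝ) + s)
        * ((m : ℝ) + l) ^ (((l - s : ℕ) : ℤ) - 1)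
      = ((m : ℝ) + 1) * ((m : ℝ) + 1 + l) ^ ((l : ℤ) - 1) := by
  have hN : (0 : ℝ) < (m : ℝ) + l := by exact_mod_cast h
  have hN1 : ((m : ℝ) + l) + 1 ≠ 0 := by positivity
  have e : (m : ℝ) + 1 + l = ((m : ℝ) + l) + 1 := by ring
  rw [e, zpow_sub_one₀ hN1, zpow_natCast]
  have h1 : ∀ s ∈ Finset.range (l + 1), (l.choose s : ℝ) * ((m : ℝ) + s)
        * ((m : ℝ) + l) ^ (((l - s : ℕ) : ℤ) - 1) =
      (m * ((l.choose s : ℝ) * ((m : ℝ) + l) ^ (l - s))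
        + (l.choose s : ℝ) * s * ((m : ℝ) + l) ^ (l - s)) * ((m : ℝ) + l)⁻¹ := by
    intro s _
    rw [zpow_sub_one₀ hN.ne', zpow_natCast]
    ring
  rw [Finset.sum_congr rfl h1, ← Finset.sum_mul, Finset.sum_add_distrib, ← Finset.mul_sum,
    sum_choose_pow, eq_div_of_mul_eq hN1 (sum_choose_mul_pow _ l)]
  field_simp
  ring

/-- `K_{1,0} = 1`, `K_{0,ℓ} = 0`, and for all `n ≥ 1`, `ℓ ≥ 0` with `n + ℓ ≥ 2` the
Kirkwood–Salsburg recursion `K_{n,ℓ} = α ∑_{s=0}^{ℓ} (c^s/s!) K_{n-1+s, ℓ-s}` holds. -/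
theorem statement10 (α c : ℝ) (hα : 0 < α) (hc : 0 < c) :
    KS α c 1 0 = 1 ∧
    (∀ ℓ : ℕ, KS α c 0 ℓ = 0) ∧
    ∀ (n ℓ : ℕ), 1 ≤ n → 2 ≤ n + ℓ →
      KS α c n ℓ =
        α * ∑ s ∈ Finset.range (ℓ + 1),
          c ^ s / (s.factorial : ℝ) * KS α c (n - 1 + s) (ℓ - s) := by
  refine ⟨by simp [KS], fun ℓ => by simp [KS], ?_⟩
  intro n ℓ hn h2
  obtain ⟨m, rfl⟩ : ∃ m, n = m + 1 := ⟨n - 1, by omega⟩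
  have hk := key m ℓ (by omega)
  have h1 : ∀ s ∈ Finset.range (ℓ + 1),
      c ^ s / (s.factorial : ℝ) * KS α c (m + 1 - 1 + s) (ℓ - s) =
      (α ^ (m + ℓ - 1) * c ^ ℓ / (ℓ.factorial : ℝ)) *
       ((ℓ.choose s : ℝ) * ((m : ℝ) + s) * ((m : ℝ) + ℓ) ^ (((ℓ - s : ℕ) : ℤ) - 1)) := by
    intro s hs
    have hs' : s ≤ ℓ := by simpa [Nat.lt_succ_iff] using hs
    have a1 : m + 1 - 1 + s = m + s := by omega
    have a2 : m + s + (ℓ - s) - 1 = m + ℓ - 1 := by omega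
    have a3 : ((m + s : ℕ) : ℝ) + ((ℓ - s : ℕ) : ℝ) = (m : ℝ) + ℓ := by
      push_cast [Nat.cast_sub hs']; ring
    have a4 : c ^ ℓ = c ^ s * c ^ (ℓ - s) := by rw [← pow_add]; congr 1; omega
    rw [KS_eq, a1, a2, a3, a4, Nat.cast_choose ℝ hs']
    have f1 : (s.factorial : ℝ) ≠ 0 := by positivity
    have f2 : ((ℓ - s).factorial : ℝ) ≠ 0 := by positivity
    have f3 : (ℓ.factorial : ℝ) ≠ 0 := by positivity
    push_cast
    generalize ((m : ℝ) + ℓ) ^ (((ℓ - s : ℕ) : ℤ) - 1) = Z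
    field_simp
  rw [Finset.sum_congr rfl h1, ← Finset.mul_sum, hk]
  have a5 : α ^ (m + ℓ) = α * α ^ (m + ℓ - 1) := by
    rw [← pow_succ']; congr 1; omega
  simp only [KS]
  rw [a5]
  ring

end
end

section
/- (General Penrose identity) Let n ≥ 2 and, for each unordered pair {i,j} ⊆ {1, …, n}, let V_{ij} ∈ ℝ ∪ {+∞}, with the convention e^{−(+∞)} = 0. Let 𝔐 : T_n → G_n be a partition scheme. Then ∑_{g∈G_n} ∏_{{i,j}∈E_g} (e^{−V_{ij}} − 1) = ∑_{τ∈T_n} exp(−∑_{{i,j}∈E_{𝔐(τ)}∖E_τ} V_{ij}) · ∏_{{i,j}∈E_τ} (e^{−V_{ij}} − 1). -/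
open scoped BigOperators

noncomputable section
open Classical

/-- `e^{-v}` for `v ∈ ℝ ∪ {+∞}`, with the convention `e^{-∞} = 0`. -/
def expNeg (v : WithTop ℝ) : ℝ := WithTop.recTopCoe 0 (fun a => Real.exp (-a)) v

/-- A map `𝔐` from trees on `{1,…,n}` to connected graphs on `{1,…,n}` is a partition
scheme if `τ ⊆ 𝔐(τ)` for every tree `τ` and every connected graph `g` belongs to exactly
one boolean interval `[τ, 𝔐(τ)] = {g : τ ⊆ g ⊆ 𝔐(τ)}`. -/
def IsPartitionScheme {n : ℕ} (M : SimpleGraph (Fin n) → SimpleGraph (Fin n)) : Prop :=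
  (∀ τ : SimpleGraph (Fin n), τ.IsTree → τ ≤ M τ) ∧
  ∀ g : SimpleGraph (Fin n), g.Connected →
    ∃! τ : SimpleGraph (Fin n), τ.IsTree ∧ τ ≤ g ∧ g ≤ M τ

theorem mem_edgePairs {n : ℕ} (g : SimpleGraph (Fin n)) (p : Fin n × Fin n) :
    p ∈ edgePairs g ↔ p.1 < p.2 ∧ g.Adj p.1 p.2 := by
  simp [edgePairs]

theorem edgePairs_subset_iff {n : ℕ} (g h : SimpleGraph (Fin n)) :
    edgePairs g ⊆ edgePairs h ↔ g ≤ h := by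
  constructor
  · intro H a b hab
    rcases lt_trichotomy a b with hlt | heq | hlt
    · exact ((mem_edgePairs h (a, b)).1 (H ((mem_edgePairs g (a, b)).2 ⟨hlt, hab⟩))).2
    · exact absurd heq hab.ne
    · exact ((mem_edgePairs h (b, a)).1
        (H ((mem_edgePairs g (b, a)).2 ⟨hlt, hab.symm⟩))).2.symm
  · intro H p hp
    rw [mem_edgePairs] at hp ⊢
    exact ⟨hp.1, H hp.2⟩

theorem edgePairs_injective {n : ℕ} {g h : SimpleGraph (Fin n)}
    (H : edgePairs g = edgePairs h) : g = h :=
  le_antisymm ((edgePairs_subset_iff g h).1 H.subset) ((edgePairs_subset_iff h g).1 H.symm.subset)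

theorem exists_edgePairs_eq {n : ℕ} (s : Finset (Fin n × Fin n)) (hs : ∀ p ∈ s, p.1 < p.2) :
    ∃ g : SimpleGraph (Fin n), edgePairs g = s := by
  refine ⟨SimpleGraph.fromRel (fun a b => (a, b) ∈ s), ?_⟩
  ext ⟨a, b⟩
  rw [mem_edgePairs, SimpleGraph.fromRel_adj]
  constructor
  · rintro ⟨h1, h2, h3 | h3⟩
    · exact h3
    · exact absurd (hs _ h3) (not_lt.2 h1.le)
  · intro h
    exact ⟨hs _ h, (hs _ h).ne, Or.inl h⟩

theorem expNeg_add (a b : WithTop ℝ) : expNeg (a + b) = expNeg a * expNeg b := by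
  induction a using WithTop.recTopCoe with
  | top => rw [top_add]; simp [expNeg]
  | coe x =>
    induction b using WithTop.recTopCoe with
    | top => rw [add_top]; simp [expNeg]
    | coe y =>
      rw [← WithTop.coe_add]
      simp only [expNeg, WithTop.recTopCoe_coe]
      rw [neg_add, Real.exp_add]

theorem expNeg_sum {ι : Type*} (s : Finset ι) (f : ι → WithTop ℝ) :
    expNeg (∑ i ∈ s, f i) = ∏ i ∈ s, expNeg (f i) := by
  induction s using Finset.induction_on with
  | empty =>
    rw [Finset.sum_empty, Finset.prod_empty, ← WithTop.coe_zero]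
    simp only [expNeg, WithTop.recTopCoe_coe, neg_zero, Real.exp_zero]
  | insert a s ha ih => rw [Finset.sum_insert ha, Finset.prod_insert ha, expNeg_add, ih]

theorem sum_interval {n : ℕ} (f : Fin n × Fin n → ℝ) (τ m : SimpleGraph (Fin n)) (h : τ ≤ m) :
    ∑ g ∈ (Finset.univ : Finset (SimpleGraph (Fin n))).filter (fun g => τ ≤ g ∧ g ≤ m),
      ∏ p ∈ edgePairs g, (f p - 1) =
    (∏ p ∈ edgePairs m \ edgePairs τ, f p) * ∏ p ∈ edgePairs τ, (f p - 1) := by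
  have h1 : ∏ p ∈ edgePairs m \ edgePairs τ, f p =
      ∑ t ∈ (edgePairs m \ edgePairs τ).powerset, ∏ p ∈ t, (f p - 1) := by
    rw [← Finset.prod_one_add]
    exact Finset.prod_congr rfl fun p _ => by ring
  rw [h1, Finset.sum_mul]
  refine Finset.sum_bij (fun g _ => edgePairs g \ edgePairs τ) ?_ ?_ ?_ ?_
  · intro g hg
    have hg := (Finset.mem_filter.1 hg).2
    exact Finset.mem_powerset.2
      (Finset.sdiff_subset_sdiff ((edgePairs_subset_iff _ _).2 hg.2) (Finset.Subset.refl _))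
  · intro g hg g' hg' he
    have hg := (edgePairs_subset_iff _ _).2 (Finset.mem_filter.1 hg).2.1
    have hg' := (edgePairs_subset_iff _ _).2 (Finset.mem_filter.1 hg').2.1
    apply edgePairs_injective
    rw [← Finset.sdiff_union_of_subset hg, ← Finset.sdiff_union_of_subset hg']
    exact congrArg (· ∪ edgePairs τ) he
  · intro t ht
    have ht := Finset.mem_powerset.1 ht
    obtain ⟨g, hg⟩ := exists_edgePairs_eq (t ∪ edgePairs τ) (by
      intro p hp
      rcases Finset.mem_union.1 hp with hp | hp
      · exact ((mem_edgePairs _ _).1 (Finset.mem_sdiff.1 (ht hp)).1).1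
      · exact ((mem_edgePairs _ _).1 hp).1)
    refine ⟨g, Finset.mem_filter.2 ⟨Finset.mem_univ _, ?_, ?_⟩, ?_⟩
    · rw [← edgePairs_subset_iff, hg]
      exact Finset.subset_union_right
    · rw [← edgePairs_subset_iff, hg]
      exact Finset.union_subset (ht.trans Finset.sdiff_subset) ((edgePairs_subset_iff _ _).2 h)
    · change edgePairs g \ edgePairs τ = t
      rw [hg, Finset.union_sdiff_right]
      exact Finset.sdiff_eq_self_of_disjoint
        (Finset.disjoint_of_subset_left ht Finset.sdiff_disjoint)
  · intro g hg
    exact (Finset.prod_sdiff ((edgePairs_subset_iff _ _).2 (Finset.mem_filter.1 hg).2.1)).symm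

/-- General Penrose identity: for any partition scheme `𝔐`,
`∑_{g∈G_n} ∏_{{i,j}∈E_g} (e^{-V_{ij}}-1)
  = ∑_{τ∈T_n} e^{-∑_{{i,j}∈E_{𝔐(τ)}∖E_τ} V_{ij}} ∏_{{i,j}∈E_τ}(e^{-V_{ij}}-1)`,
for weights `V_{ij} ∈ ℝ ∪ {+∞}` indexed by unordered pairs. -/
theorem statement11 (n : ℕ) (hn : 2 ≤ n) (V : Sym2 (Fin n) → WithTop ℝ)
    (M : SimpleGraph (Fin n) → SimpleGraph (Fin n)) (hM : IsPartitionScheme M) :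
    (∑ g ∈ (Finset.univ : Finset (SimpleGraph (Fin n))).filter (fun g => g.Connected),
        ∏ p ∈ edgePairs g, (expNeg (V s(p.1, p.2)) - 1)) =
      ∑ τ ∈ (Finset.univ : Finset (SimpleGraph (Fin n))).filter (fun τ => τ.IsTree),
        expNeg (∑ p ∈ edgePairs (M τ) \ edgePairs τ, V s(p.1, p.2)) *
          ∏ p ∈ edgePairs τ, (expNeg (V s(p.1, p.2)) - 1) := by
  have key : ∀ g ∈ (Finset.univ : Finset (SimpleGraph (Fin n))).filter (fun g => g.Connected),
      ∏ p ∈ edgePairs g, (expNeg (V s(p.1, p.2)) - 1) =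
      ∑ τ ∈ (Finset.univ : Finset (SimpleGraph (Fin n))).filter (fun τ => τ.IsTree),
        if τ ≤ g ∧ g ≤ M τ then ∏ p ∈ edgePairs g, (expNeg (V s(p.1, p.2)) - 1) else 0 := by
    intro g hg
    obtain ⟨τ, ⟨h1, h2⟩, h3⟩ := hM.2 g (Finset.mem_filter.1 hg).2
    rw [Finset.sum_eq_single τ]
    · rw [if_pos h2]
    · intro σ hσ hne
      exact if_neg fun hh => hne (h3 σ ⟨(Finset.mem_filter.1 hσ).2, hh⟩)
    · intro hh
      exact absurd (Finset.mem_filter.2 ⟨Finset.mem_univ _, h1⟩) hh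
  rw [Finset.sum_congr rfl key, Finset.sum_comm]
  refine Finset.sum_congr rfl fun τ hτ => ?_
  have hτ := (Finset.mem_filter.1 hτ).2
  rw [expNeg_sum, ← sum_interval (fun p => expNeg (V s(p.1, p.2))) τ (M τ) (hM.1 τ hτ),
    ← Finset.sum_filter, Finset.filter_filter]
  refine Finset.sum_congr ?_ fun _ _ => rfl
  ext g
  simp only [Finset.mem_filter, Finset.mem_univ, true_and]
  exact ⟨fun h => h.2, fun h => ⟨hτ.connected.mono h.1, h⟩⟩

end
end

section
/- (Minimal spanning tree partition scheme) Let n ≥ 2 and let ≻ be a strict linear order on the set of unordered pairs {i,j} ⊆ {1, …, n}. For a tree τ ∈ T_n, let 𝐌(τ) be the graph on {1, …, n} whose edges are exactly those pairs {i,j} such that {i,j} ≽ e for every edge e lying on the unique path in τ from i to j. Then E_τ ⊆ E_{𝐌(τ)} for every τ, and for every connected graph g ∈ G_n there exists exactly one tree τ ∈ T_n with E_τ ⊆ E_g ⊆ E_{𝐌(τ)}; i.e. 𝐌 is a partition scheme on G_n. -/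
open scoped BigOperators

noncomputable section
open Classical

/-- The minimal-spanning-tree partition scheme associated to a strict order `succ`
(`succ e f` meaning `e ≻ f`) on the unordered pairs: `𝐌(τ)` has as edges exactly those
pairs `{i,j}` such that `{i,j} ≽ e` for every edge `e` on the (unique) path in `τ`
from `i` to `j`. -/
def mstScheme {n : ℕ} (succ : Sym2 (Fin n) → Sym2 (Fin n) → Prop)
    (τ : SimpleGraph (Fin n)) : SimpleGraph (Fin n) :=
  SimpleGraph.fromRel (fun i j =>
    ∀ (w : τ.Walk i j), w.IsPath → ∀ e ∈ w.edges, e = s(i, j) ∨ succ s(i, j) e)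

/-- Edges of `g` strictly below `e`. -/
def lowGraph {n : ℕ} (succ : Sym2 (Fin n) → Sym2 (Fin n) → Prop)
    (g : SimpleGraph (Fin n)) (e : Sym2 (Fin n)) : SimpleGraph (Fin n) where
  Adj a b := g.Adj a b ∧ succ e s(a, b)
  symm := ⟨fun a b h => ⟨h.1.symm, by rw [Sym2.eq_swap]; exact h.2⟩⟩
  loopless := ⟨fun a h => g.loopless.irrefl a h.1⟩

/-- Edges of `g` that are not joined by strictly smaller edges (Kruskal). -/
def kruskal {n : ℕ} (succ : Sym2 (Fin n) → Sym2 (Fin n) → Prop)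
    (g : SimpleGraph (Fin n)) : SimpleGraph (Fin n) where
  Adj a b := g.Adj a b ∧ ¬ (lowGraph succ g s(a, b)).Reachable a b
  symm := ⟨fun a b h => ⟨h.1.symm, by
    rw [Sym2.eq_swap]; exact fun h' => h.2 h'.symm⟩⟩
  loopless := ⟨fun a h => g.loopless.irrefl a h.1⟩

theorem mst_path {n : ℕ} {succ : Sym2 (Fin n) → Sym2 (Fin n) → Prop}
    {τ : SimpleGraph (Fin n)} {a b : Fin n} (h : (mstScheme succ τ).Adj a b)
    (w : τ.Walk a b) (hw : w.IsPath) (e : Sym2 (Fin n)) (he : e ∈ w.edges) :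
    e = s(a, b) ∨ succ s(a, b) e := by
  rw [mstScheme, SimpleGraph.fromRel_adj] at h
  rcases h.2 with h | h
  · exact h w hw e he
  · have := h w.reverse hw.reverse e (by simpa using he)
    rwa [Sym2.eq_swap] at this

theorem reachable_of_adj_reachable {V : Type*} {G H : SimpleGraph V}
    (h : ∀ a b, G.Adj a b → H.Reachable a b) {a b : V} (hr : G.Reachable a b) :
    H.Reachable a b := by
  obtain ⟨w⟩ := hr
  induction w with
  | nil => exact SimpleGraph.Reachable.refl _
  | cons hadj _ ih => exact (h _ _ hadj).trans ih

theorem reachable_of_walk {V : Type*} {G H : SimpleGraph V} {a b : V} (w : G.Walk a b)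
    (h : ∀ e ∈ w.edges, e ∈ H.edgeSet) : H.Reachable a b :=
  ⟨w.transfer H h⟩

/-- `kruskal` edges at most `e`. -/
def kruskalLe {n : ℕ} (succ : Sym2 (Fin n) → Sym2 (Fin n) → Prop)
    (g : SimpleGraph (Fin n)) (e : Sym2 (Fin n)) : SimpleGraph (Fin n) where
  Adj a b := (kruskal succ g).Adj a b ∧ (s(a, b) = e ∨ succ e s(a, b))
  symm := ⟨fun a b h => ⟨h.1.symm, by rw [Sym2.eq_swap]; exact h.2⟩⟩
  loopless := ⟨fun a h => (kruskal succ g).loopless.irrefl a h.1⟩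

theorem tree_le_mst {n : ℕ} (succ : Sym2 (Fin n) → Sym2 (Fin n) → Prop)
    (τ : SimpleGraph (Fin n)) (hτ : τ.IsTree) : τ ≤ mstScheme succ τ := by
  intro a b hab
  rw [mstScheme, SimpleGraph.fromRel_adj]
  refine ⟨hab.ne, Or.inl fun w hw e he => Or.inl ?_⟩
  have h1 := (hτ.existsUnique_path a b).unique hw
    (SimpleGraph.Walk.IsPath.of_adj hab)
  rw [h1] at he
  simpa using he

theorem eq_kruskal {n : ℕ} {succ : Sym2 (Fin n) → Sym2 (Fin n) → Prop}
    (hirr : ∀ e, ¬ succ e e)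
    (htrans : ∀ e f g, succ e f → succ f g → succ e g)
    {g τ : SimpleGraph (Fin n)} (hτ : τ.IsTree) (h1 : τ ≤ g) (h2 : g ≤ mstScheme succ τ) :
    τ = kruskal succ g := by
  ext i j
  constructor
  · intro hij
    refine ⟨h1 hij, fun hr => ?_⟩
    have hb := (SimpleGraph.isAcyclic_iff_forall_adj_isBridge.1 hτ.IsAcyclic) hij
    rw [SimpleGraph.isBridge_iff] at hb
    apply hb
    refine reachable_of_adj_reachable ?_ hr
    rintro a b ⟨hab, hs⟩
    obtain ⟨w, hw, -⟩ := hτ.existsUnique_path a b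
    refine reachable_of_walk w fun e he => ?_
    have hm := mst_path (h2 hab) w hw e he
    have hne : e ≠ s(i, j) := by
      rintro rfl
      rcases hm with hm | hm
      · rw [← hm] at hs; exact hirr _ hs
      · exact hirr _ (htrans _ _ _ hs hm)
    have := w.edges_subset_edgeSet he
    simp [this, hne]
  · rintro ⟨hij, hr⟩
    by_contra hn
    apply hr
    obtain ⟨w, hw, -⟩ := hτ.existsUnique_path i j
    refine reachable_of_walk w fun e he => ?_
    have hm := mst_path (h2 hij) w hw e he
    have ht := w.edges_subset_edgeSet he
    have hne : e ≠ s(i, j) := by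
      rintro rfl
      exact hn ht
    have hs := hm.resolve_left hne
    induction e with
    | _ a b => exact ⟨h1 ht, hs⟩

theorem kruskalLe_reachable {n : ℕ} {succ : Sym2 (Fin n) → Sym2 (Fin n) → Prop}
    (hirr : ∀ e, ¬ succ e e)
    (htrans : ∀ e f g, succ e f → succ f g → succ e g)
    (g : SimpleGraph (Fin n)) (e : Sym2 (Fin n)) :
    ∀ a b, e = s(a, b) → g.Adj a b → (kruskalLe succ g e).Reachable a b := by
  haveI : IsTrans (Sym2 (Fin n)) (flip succ) := ⟨fun a b c h1 h2 => htrans _ _ _ h2 h1⟩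
  haveI : Std.Irrefl (flip succ) := ⟨fun a => hirr a⟩
  have wf : WellFounded (flip succ) := Finite.wellFounded_of_trans_of_irrefl _
  induction e using wf.induction with
  | _ e ih =>
    rintro a b rfl hab
    by_cases hk : (lowGraph succ g s(a, b)).Reachable a b
    · refine reachable_of_adj_reachable ?_ hk
      rintro c d ⟨hcd, hs⟩
      refine (ih _ hs c d rfl hcd).mono ?_
      rintro x y ⟨hxy, hor⟩
      refine ⟨hxy, Or.inr ?_⟩
      rcases hor with h | h
      · rwa [h]
      · exact htrans _ _ _ hs h
    · exact SimpleGraph.Adj.reachable ⟨⟨hab, hk⟩, Or.inl rfl⟩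

theorem kruskal_acyclic {n : ℕ} {succ : Sym2 (Fin n) → Sym2 (Fin n) → Prop}
    (hirr : ∀ e, ¬ succ e e)
    (htrans : ∀ e f g, succ e f → succ f g → succ e g)
    (htri : ∀ e f : Sym2 (Fin n), ¬ e.IsDiag → ¬ f.IsDiag → e ≠ f →
      succ e f ∨ succ f e)
    (g : SimpleGraph (Fin n)) : (kruskal succ g).IsAcyclic := by
  intro v c hc
  haveI : IsTrans (Sym2 (Fin n)) succ := ⟨htrans⟩
  haveI : Std.Irrefl succ := ⟨hirr⟩
  have wf : WellFounded succ := Finite.wellFounded_of_trans_of_irrefl _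
  have hne : {e | e ∈ c.edges}.Nonempty := by
    cases c with
    | nil => exact absurd hc (by simp)
    | cons h p => exact ⟨_, by simp; exact Or.inl rfl⟩
  obtain ⟨e, he, hmax⟩ := wf.has_min _ hne
  set H := SimpleGraph.fromEdgeSet {e | e ∈ c.edges} with hH
  have hcH : ∀ f ∈ c.edges, f ∈ H.edgeSet := by
    intro f hf
    have := (kruskal succ g).not_isDiag_of_mem_edgeSet (c.edges_subset_edgeSet hf)
    rw [hH, SimpleGraph.edgeSet_fromEdgeSet]
    exact ⟨hf, this⟩
  have hc' := hc.transfer hcH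
  have heK := c.edges_subset_edgeSet he
  have heH := hcH e he
  have hec : e ∈ (c.transfer H hcH).edges := by simpa using he
  induction e with
  | _ i j =>
    apply heK.2
    have hnb : ¬ H.IsBridge s(i, j) := fun hb =>
      (SimpleGraph.isBridge_iff_forall_cycle_notMem heH).1 hb _ hc' hec
    rw [SimpleGraph.isBridge_iff, not_not] at hnb
    refine hnb.mono ?_
    intro a b hab
    have hab' : s(a, b) ∈ c.edges ∧ s(a, b) ≠ s(i, j) := by
      rw [SimpleGraph.deleteEdges_adj] at hab
      refine ⟨?_, fun h => hab.2 (by simp [h])⟩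
      have := hab.1
      rw [hH, SimpleGraph.fromEdgeSet_adj] at this
      exact this.1
    have hK := c.edges_subset_edgeSet hab'.1
    refine ⟨hK.1, ?_⟩
    rcases htri s(a, b) s(i, j) ((kruskal succ g).not_isDiag_of_mem_edgeSet hK)
      ((kruskal succ g).not_isDiag_of_mem_edgeSet heK) hab'.2 with h | h
    · exact absurd h (hmax _ hab'.1)
    · exact h

/-- The minimal-spanning-tree map `𝐌` is a partition scheme: `τ ⊆ 𝐌(τ)` for every tree
`τ`, and every connected graph `g` on `{1,…,n}` satisfies `τ ⊆ g ⊆ 𝐌(τ)` for exactly one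
tree `τ`. Here `succ` is a strict linear order (`succ e f` meaning `e ≻ f`) on the
unordered pairs of distinct elements of `{1,…,n}`. -/
theorem statement12 (n : ℕ) (hn : 2 ≤ n)
    (succ : Sym2 (Fin n) → Sym2 (Fin n) → Prop)
    (hirr : ∀ e, ¬ succ e e)
    (htrans : ∀ e f g, succ e f → succ f g → succ e g)
    (htri : ∀ e f : Sym2 (Fin n), ¬ e.IsDiag → ¬ f.IsDiag → e ≠ f →
      succ e f ∨ succ f e) :
    (∀ τ : SimpleGraph (Fin n), τ.IsTree → τ ≤ mstScheme succ τ) ∧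
    ∀ g : SimpleGraph (Fin n), g.Connected →
      ∃! τ : SimpleGraph (Fin n), τ.IsTree ∧ τ ≤ g ∧ g ≤ mstScheme succ τ := by
  refine ⟨fun τ hτ => tree_le_mst succ τ hτ, fun g hg => ?_⟩
  have hle : ∀ e, kruskalLe succ g e ≤ kruskal succ g := fun e a b h => h.1
  have htree : (kruskal succ g).IsTree := by
    refine ⟨?_, kruskal_acyclic hirr htrans htri g⟩
    haveI := hg.nonempty
    refine ⟨fun a b => reachable_of_adj_reachable ?_ (hg.preconnected a b)⟩
    exact fun c d hcd => (kruskalLe_reachable hirr htrans g _ c d rfl hcd).mono (hle _)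
  refine ⟨kruskal succ g, ⟨htree, fun a b h => h.1, ?_⟩,
    fun τ hτ => eq_kruskal hirr htrans hτ.1 hτ.2.1 hτ.2.2⟩
  intro a b hab
  rw [mstScheme, SimpleGraph.fromRel_adj]
  refine ⟨hab.ne, Or.inl fun w hw e he => ?_⟩
  obtain ⟨p, hp⟩ := (kruskalLe_reachable hirr htrans g _ a b rfl hab).exists_isPath
  have h1 := (htree.existsUnique_path a b).unique hw (hp.mapLe (hle s(a, b)))
  rw [h1] at he
  have he' : e ∈ p.edges := by simpa using he
  have := p.edges_subset_edgeSet he'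
  induction e with
  | _ x y => exact this.2


end
end

section
/- Let n ≥ 2, let V_{ij} ∈ ℝ ∪ {+∞} be assigned to each unordered pair {i,j} ⊆ {1, …, n}, and suppose there are nonnegative numbers B_1, …, B_n such that ∑_{{i,j}⊆S} V_{ij} ≥ −∑_{i∈S} B_i for every subset S ⊆ {1, …, n}. Let ≻ be a strict linear order on the pairs such that {i,j} ≻ {k,l} implies V_{ij} ≥ V_{kl}, and let 𝐌 be the associated minimal-spanning-tree partition scheme (𝐌(τ) has as edges those pairs {i,j} that are ≽ every edge on the path in τ from i to j). Then for every tree τ ∈ T_n, ∑_{{i,j} ∈ E_{𝐌(τ)} ∖ E_τ⁺} V_{ij} ≥ −∑_{i=1}^{n} B_i, where E_τ⁺ = {{i,j} ∈ E_τ : V_{ij} ≥ 0}. -/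
open scoped BigOperators

noncomputable section
open Classical

/-- If the weights `V_{ij} ∈ ℝ ∪ {+∞}` satisfy `∑_{{i,j}⊆S} V_{ij} ≥ -∑_{i∈S} B_i` for
every `S ⊆ {1,…,n}` (with `B_i ≥ 0`) and the strict linear order `≻` is compatible with
the weights (`e ≻ f ⟹ V_e ≥ V_f`), then for every tree `τ`,
`∑_{{i,j} ∈ E_{𝐌(τ)} ∖ E_τ⁺} V_{ij} ≥ -∑_i B_i`, where `E_τ⁺` is the set of edges of `τ`
with nonnegative weight and `𝐌` is the minimal-spanning-tree partition scheme. -/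
theorem statement13 (n : ℕ) (hn : 2 ≤ n) (V : Sym2 (Fin n) → WithTop ℝ)
    (B : Fin n → ℝ) (hB : ∀ i, 0 ≤ B i)
    (hstab : ∀ S : Finset (Fin n),
      ((-(∑ i ∈ S, B i) : ℝ) : WithTop ℝ) ≤
        ∑ p ∈ Finset.univ.filter
            (fun p : Fin n × Fin n => p.1 < p.2 ∧ p.1 ∈ S ∧ p.2 ∈ S),
          V s(p.1, p.2))
    (succ : Sym2 (Fin n) → Sym2 (Fin n) → Prop)
    (hirr : ∀ e, ¬ succ e e)
    (htrans : ∀ e f g, succ e f → succ f g → succ e g)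
    (htri : ∀ e f : Sym2 (Fin n), ¬ e.IsDiag → ¬ f.IsDiag → e ≠ f →
      succ e f ∨ succ f e)
    (hcomp : ∀ e f : Sym2 (Fin n), succ e f → V f ≤ V e) :
    ∀ τ : SimpleGraph (Fin n), τ.IsTree →
      ((-(∑ i, B i) : ℝ) : WithTop ℝ) ≤
        ∑ p ∈ edgePairs (mstScheme succ τ) \
            ((edgePairs τ).filter fun p => (0 : WithTop ℝ) ≤ V s(p.1, p.2)),
          V s(p.1, p.2) := by
  intro τ hτ
  let N : SimpleGraph (Fin n) :=
    { Adj := fun i j => τ.Adj i j ∧ V s(i, j) < 0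
      symm := ⟨fun i j h => ⟨h.1.symm, by rw [Sym2.eq_swap]; exact h.2⟩⟩
      loopless := ⟨fun i h => τ.loopless.irrefl i h.1⟩ }
  have hNτ : N ≤ τ := fun i j h => h.1
  have hNe : ∀ e ∈ N.edgeSet, V e < 0 := by
    intro e
    induction e using Sym2.ind with
    | _ i j => intro h; exact h.2
  -- edges of any tree path between vertices in the same component are negative
  have key : ∀ i j, N.Reachable i j → ∀ w : τ.Walk i j, w.IsPath → ∀ e ∈ w.edges, V e < 0 := by
    intro i j h w hw e he
    obtain ⟨q, hq⟩ := h.exists_isPath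
    have h1 : (q.mapLe hNτ).IsPath := (SimpleGraph.Walk.isPath_mapLe hNτ).2 hq
    have h2 : w = q.mapLe hNτ := hτ.existsUnique_path i j |>.unique hw h1
    rw [h2, SimpleGraph.Walk.edges_mapLe_eq_edges] at he
    exact hNe e (q.edges_subset_edgeSet he)
  have key2 : ∀ i j, ¬ N.Reachable i j → ∀ w : τ.Walk i j, ∃ e ∈ w.edges, 0 ≤ V e := by
    intro i j h w
    by_contra! hc
    apply h
    refine ⟨w.transfer N ?_⟩
    intro e he
    have h1 := w.edges_subset_edgeSet he
    have h2 := hc e he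
    revert h1 h2
    induction e using Sym2.ind with
    | _ i j => intro h1 h2; exact ⟨h1, h2⟩
  set F := edgePairs (mstScheme succ τ) \
            ((edgePairs τ).filter fun p => (0 : WithTop ℝ) ≤ V s(p.1, p.2)) with hF
  have step1 : ∑ p ∈ Finset.univ.filter
      (fun p : Fin n × Fin n => p.1 < p.2 ∧ N.Reachable p.1 p.2), V s(p.1, p.2)
      ≤ ∑ p ∈ F, V s(p.1, p.2) := by
    have e1 : ∑ p ∈ F, V s(p.1, p.2) = ∑ p, if p ∈ F then V s(p.1, p.2) else 0 := by
      rw [← Finset.sum_filter]; simp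
    rw [e1, Finset.sum_filter]
    apply Finset.sum_le_sum
    rintro ⟨i, j⟩ -
    by_cases hlt : i < j
    swap
    · have : (i, j) ∉ F := by simp [hF, edgePairs, hlt]
      simp [this, hlt]
    by_cases hr : N.Reachable i j
    · by_cases hp : (i, j) ∈ F
      · simp [hp, hlt, hr]
      · simp only [hlt, hr, hp, and_self, if_true, if_false]
        by_cases hM : (mstScheme succ τ).Adj i j
        · have h3 : τ.Adj i j := by
            by_contra h4
            exact hp (by simp [hF, edgePairs, hlt, hM, h4])
          refine (key i j hr h3.toWalk ?_ s(i, j) (by simp)).le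
          simp [hlt.ne]
        · have h4 : ¬ ∀ (w : τ.Walk i j), w.IsPath → ∀ e ∈ w.edges,
              e = s(i, j) ∨ succ s(i, j) e := by
            intro h
            exact hM (by rw [mstScheme, SimpleGraph.fromRel_adj]; exact ⟨hlt.ne, Or.inl h⟩)
          push Not at h4
          obtain ⟨w, hw, e, he, hne, hns⟩ := h4
          have hd : ¬ e.IsDiag := τ.not_isDiag_of_mem_edgeSet (w.edges_subset_edgeSet he)
          have hs : succ e s(i, j) :=
            (htri e s(i, j) hd (by simpa using hlt.ne) hne).resolve_right hns
          exact (hcomp _ _ hs).trans (key i j hr w hw e he).le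
    · simp only [hr, and_false, if_false]
      split_ifs with hp
      · have hM : (mstScheme succ τ).Adj i j := by
          have := (Finset.mem_sdiff.1 hp).1
          simp only [edgePairs, Finset.mem_filter] at this
          exact this.2.2
        rw [mstScheme, SimpleGraph.fromRel_adj] at hM
        obtain ⟨w, hw, -⟩ := hτ.existsUnique_path i j
        obtain ⟨e, he, hV⟩ := key2 i j hr w
        have : e = s(i, j) ∨ succ s(i, j) e := by
          rcases hM.2 with h | h
          · exact h w hw e he
          · have := h w.reverse hw.reverse e (by simpa using he)
            rwa [Sym2.eq_swap] at this
        rcases this with h | h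
        · exact h ▸ hV
        · exact hV.trans (hcomp _ _ h)
      · exact le_rfl
  refine le_trans ?_ step1
  let S : N.ConnectedComponent → Finset (Fin n) := fun c =>
    Finset.univ.filter fun i => N.connectedComponentMk i = c
  have e2 : ∑ p ∈ Finset.univ.filter
      (fun p : Fin n × Fin n => p.1 < p.2 ∧ N.Reachable p.1 p.2), V s(p.1, p.2)
      = ∑ c, ∑ p ∈ Finset.univ.filter
            (fun p : Fin n × Fin n => p.1 < p.2 ∧ p.1 ∈ S c ∧ p.2 ∈ S c), V s(p.1, p.2) := by
    rw [← Finset.sum_fiberwise _ (fun p : Fin n × Fin n => N.connectedComponentMk p.1)]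
    refine Finset.sum_congr rfl fun c _ => Finset.sum_congr ?_ fun _ _ => rfl
    ext p
    simp only [Finset.mem_filter, Finset.mem_univ, true_and, S,
      ← SimpleGraph.ConnectedComponent.eq]
    grind
  have e3 : ((-(∑ i, B i) : ℝ) : WithTop ℝ) =
      ∑ c, ((-(∑ i ∈ S c, B i) : ℝ) : WithTop ℝ) := by
    rw [← WithTop.coe_sum, Finset.sum_neg_distrib,
      ← Finset.sum_fiberwise Finset.univ N.connectedComponentMk]
  rw [e2, e3]
  exact Finset.sum_le_sum fun c _ => hstab (S c)

end
end

section
/- (Tree-graph inequality) Let n ≥ 2 and let V_{ij} ∈ ℝ ∪ {+∞} be assigned to each unordered pair {i,j} ⊆ {1, …, n}, with the convention e^{−(+∞)} = 0. Suppose there are nonnegative numbers B_1, …, B_n such that ∑_{{i,j}⊆S} V_{ij} ≥ −∑_{i∈S} B_i for every subset S ⊆ {1, …, n}. Then |∑_{g∈G_n} ∏_{{i,j}∈E_g} (e^{−V_{ij}} − 1)| ≤ e^{∑_{i=1}^{n} B_i} · ∑_{τ∈T_n} ∏_{{i,j}∈E_τ} (1 − e^{−|V_{ij}|}). -/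
open scoped BigOperators

noncomputable section
open Classical

/-- `e^{-|v|}` for `v ∈ ℝ ∪ {+∞}`, with the conventions `|+∞| = +∞`, `e^{-∞} = 0`. -/
def expNegAbs (v : WithTop ℝ) : ℝ := WithTop.recTopCoe 0 (fun a => Real.exp (-|a|)) v

namespace TG
open Finset

variable {n : ℕ}

/-- The graph with the given set of edges, listed as pairs. -/
def gr (A : Finset (Fin n × Fin n)) : SimpleGraph (Fin n) :=
  SimpleGraph.fromEdgeSet ((fun p : Fin n × Fin n => s(p.1, p.2)) '' (A : Set (Fin n × Fin n)))

lemma gr_insert (e : Fin n × Fin n) (A : Finset (Fin n × Fin n)) :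
    gr (insert e A) = SimpleGraph.edge e.1 e.2 ⊔ gr A := by
  unfold gr SimpleGraph.edge
  rw [Finset.coe_insert, Set.image_insert_eq, Set.insert_eq]
  exact SimpleGraph.fromEdgeSet_union _ _

lemma gr_empty : gr (∅ : Finset (Fin n × Fin n)) = ⊥ := by
  simp [gr]

/-- Sum over the subsets of `l` completing `F` to a graph with property `P`. -/
def X (P : SimpleGraph (Fin n) → Prop) (w : Fin n × Fin n → ℝ) (F : SimpleGraph (Fin n))
    (l : Finset (Fin n × Fin n)) : ℝ :=
  ∑ A ∈ l.powerset, if P (F ⊔ gr A) then ∏ p ∈ A, w p else 0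

lemma X_empty (P : SimpleGraph (Fin n) → Prop) (w : Fin n × Fin n → ℝ) (F : SimpleGraph (Fin n)) :
    X P w F ∅ = if P F then 1 else 0 := by
  simp [X, gr_empty]

lemma X_insert (P : SimpleGraph (Fin n) → Prop) (w : Fin n × Fin n → ℝ) (F : SimpleGraph (Fin n))
    (l : Finset (Fin n × Fin n)) (e : Fin n × Fin n) (he : e ∉ l) :
    X P w F (insert e l) = X P w F l + w e * X P w (F ⊔ SimpleGraph.edge e.1 e.2) l := by
  unfold X
  rw [Finset.sum_powerset_insert he, Finset.mul_sum]
  congr 1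
  refine Finset.sum_congr rfl fun A hA => ?_
  have hA' : e ∉ A := fun h => he (Finset.mem_powerset.1 hA h)
  rw [gr_insert, Finset.prod_insert hA', sup_assoc]
  split_ifs <;> simp

lemma X_nonneg (P : SimpleGraph (Fin n) → Prop) (w : Fin n × Fin n → ℝ) (F : SimpleGraph (Fin n))
    (l : Finset (Fin n × Fin n)) (hw : ∀ e, 0 ≤ w e) : 0 ≤ X P w F l := by
  unfold X
  refine Finset.sum_nonneg fun A _ => ?_
  split_ifs
  · exact Finset.prod_nonneg fun e _ => hw e
  · exact le_rfl

lemma reach_sup (H : SimpleGraph (Fin n)) {a b : Fin n} (h : H.Reachable a b) {x y : Fin n}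
    (hxy : (H ⊔ SimpleGraph.edge a b).Reachable x y) : H.Reachable x y := by
  obtain ⟨p⟩ := hxy
  induction p with
  | nil => exact SimpleGraph.Reachable.refl _
  | cons hadj _ ih =>
    refine SimpleGraph.Reachable.trans ?_ ih
    rw [SimpleGraph.sup_adj, SimpleGraph.edge_adj] at hadj
    rcases hadj with h1 | ⟨⟨rfl, rfl⟩ | ⟨rfl, rfl⟩, _⟩
    · exact h1.reachable
    · exact h
    · exact h.symm

lemma conn_sup (H : SimpleGraph (Fin n)) {a b : Fin n} (h : H.Reachable a b) :
    (H ⊔ SimpleGraph.edge a b).Connected ↔ H.Connected := by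
  constructor
  · intro hc
    have := hc.nonempty
    exact ⟨fun x y => reach_sup H h (hc.preconnected x y)⟩
  · intro hc
    exact hc.mono le_sup_left

lemma X_conn (w : Fin n × Fin n → ℝ) (F : SimpleGraph (Fin n))
    (l : Finset (Fin n × Fin n)) {a b : Fin n} (h : F.Reachable a b) :
    X SimpleGraph.Connected w (F ⊔ SimpleGraph.edge a b) l = X SimpleGraph.Connected w F l := by
  unfold X
  refine Finset.sum_congr rfl fun A _ => ?_
  have : F ⊔ SimpleGraph.edge a b ⊔ gr A = (F ⊔ gr A) ⊔ SimpleGraph.edge a b := by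
    rw [sup_assoc, sup_comm (SimpleGraph.edge a b), sup_assoc]
  rw [this]
  have hc := conn_sup (F ⊔ gr A) (h.mono (le_sup_left : F ≤ F ⊔ gr A))
  by_cases h' : (F ⊔ gr A).Connected
  · rw [if_pos h', if_pos (hc.2 h')]
  · rw [if_neg h', if_neg (fun h'' => h' (hc.1 h''))]

/-- Product of `u` over the pairs of `D` inside the components of `F`. -/
def K (u : Fin n × Fin n → ℝ) (F : SimpleGraph (Fin n)) (D : Finset (Fin n × Fin n)) : ℝ :=
  ∏ p ∈ D, if F.Reachable p.1 p.2 then u p else 1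

lemma K_nonneg (u : Fin n × Fin n → ℝ) (hu : ∀ e, 0 ≤ u e) (F : SimpleGraph (Fin n))
    (D : Finset (Fin n × Fin n)) : 0 ≤ K u F D := by
  refine Finset.prod_nonneg fun e _ => ?_
  split_ifs
  · exact hu e
  · exact zero_le_one

lemma acyc_sup {F : SimpleGraph (Fin n)} (hF : F.IsAcyclic) {a b : Fin n}
    (h : ¬ F.Reachable a b) : (F ⊔ SimpleGraph.edge a b).IsAcyclic :=
  SimpleGraph.IsAcyclic.sup_edge_of_not_reachable h hF

lemma reach_new (F : SimpleGraph (Fin n)) (a b : Fin n) :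
    (F ⊔ SimpleGraph.edge a b).Reachable a b := by
  by_cases hab : a = b
  · subst hab; exact SimpleGraph.Reachable.refl _
  · apply SimpleGraph.Adj.reachable
    rw [SimpleGraph.sup_adj, SimpleGraph.edge_adj]
    exact Or.inr ⟨Or.inl ⟨rfl, rfl⟩, hab⟩

lemma phase2 (u t : Fin n × Fin n → ℝ) (hu : ∀ e, 0 ≤ u e) (ht : ∀ e, 0 ≤ t e)
    (l : Finset (Fin n × Fin n)) (hl : ∀ e ∈ l, u e ≤ 1 ∧ 1 - u e ≤ t e)
    (F : SimpleGraph (Fin n)) (hF : F.IsAcyclic) :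
    |X SimpleGraph.Connected (fun e => u e - 1) F l| ≤ K u F l * X SimpleGraph.IsTree t F l := by
  induction l using Finset.induction_on generalizing F with
  | empty =>
    rw [X_empty, X_empty]
    by_cases hc : F.Connected
    · have : F.IsTree := ⟨hc, hF⟩
      simp [hc, this, K]
    · have : ¬ F.IsTree := fun h => hc h.1
      simp [hc, this]
  | insert e l he ih =>
    have ih := ih (fun e' h' => hl e' (Finset.mem_insert_of_mem h'))
    obtain ⟨h1, h2⟩ := hl e (Finset.mem_insert_self _ _)
    have h0 := hu e
    rw [X_insert _ _ _ _ _ he, X_insert _ _ _ _ _ he]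
    have hT := X_nonneg SimpleGraph.IsTree t F l ht
    have hT' := X_nonneg SimpleGraph.IsTree t (F ⊔ SimpleGraph.edge e.1 e.2) l ht
    have hK := K_nonneg u hu F l
    by_cases hr : F.Reachable e.1 e.2
    · rw [X_conn _ _ _ hr]
      have hKi : K u F (insert e l) = u e * K u F l := by
        simp [K, Finset.prod_insert he, hr]
      rw [hKi]
      have e1 : X SimpleGraph.Connected (fun e => u e - 1) F l
          + (u e - 1) * X SimpleGraph.Connected (fun e => u e - 1) F l
          = u e * X SimpleGraph.Connected (fun e => u e - 1) F l := by ring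
      rw [e1, abs_mul, abs_of_nonneg h0, mul_assoc]
      refine mul_le_mul_of_nonneg_left ((ih F hF).trans ?_) h0
      refine mul_le_mul_of_nonneg_left ?_ hK
      have := mul_nonneg (ht e) hT'
      linarith
    · have hKi : K u F (insert e l) = K u F l := by
        simp [K, Finset.prod_insert he, hr]
      rw [hKi, mul_add]
      refine (abs_add_le _ _).trans (add_le_add (ih F hF) ?_)
      rw [abs_mul, abs_of_nonpos (by linarith : u e - 1 ≤ 0)]
      have hKm : K u (F ⊔ SimpleGraph.edge e.1 e.2) l ≤ K u F l := by
        refine Finset.prod_le_prod (fun i _ => ?_) (fun i hi => ?_)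
        · split_ifs
          · exact hu i
          · exact zero_le_one
        · by_cases hi' : F.Reachable i.1 i.2
          · simp [hi', hi'.mono (le_sup_left : F ≤ F ⊔ SimpleGraph.edge e.1 e.2)]
          · simp only [hi', if_false]
            split_ifs
            · exact (hl i (Finset.mem_insert_of_mem hi)).1
            · exact le_rfl
      calc -(u e - 1) * |X SimpleGraph.Connected (fun e => u e - 1) (F ⊔ SimpleGraph.edge e.1 e.2) l|
          ≤ t e * (K u F l * X SimpleGraph.IsTree t (F ⊔ SimpleGraph.edge e.1 e.2) l) := by
            refine mul_le_mul (by linarith) ((ih _ (acyc_sup hF hr)).trans ?_) (abs_nonneg _) (ht e)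
            exact mul_le_mul_of_nonneg_right hKm hT'
        _ = _ := by ring

lemma phase1 (u t : Fin n × Fin n → ℝ) (hu : ∀ e, 0 ≤ u e) (ht : ∀ e, 0 ≤ t e) (M : ℝ)
    (hM : 0 ≤ M) (L N : Finset (Fin n × Fin n)) (hLN : Disjoint L N)
    (hN : ∀ e ∈ N, 1 ≤ u e ∧ u e - 1 ≤ t e * u e)
    (hbase : ∀ F : SimpleGraph (Fin n), F.IsAcyclic →
      |X SimpleGraph.Connected (fun e => u e - 1) F L| * K u F N ≤ M * X SimpleGraph.IsTree t F L)
    (l : Finset (Fin n × Fin n)) (D : Finset (Fin n × Fin n)) (hD : Disjoint D l) (hDl : D ∪ l = N)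
    (F : SimpleGraph (Fin n)) (hF : F.IsAcyclic) :
    |X SimpleGraph.Connected (fun e => u e - 1) F (l ∪ L)| * K u F D
      ≤ M * X SimpleGraph.IsTree t F (l ∪ L) := by
  induction l using Finset.induction_on generalizing F D with
  | empty =>
    rw [Finset.union_empty] at hDl
    subst hDl
    simpa using hbase F hF
  | insert e l he ih =>
    have heN : e ∈ N := by rw [← hDl]; simp
    have heL : e ∉ L := fun h => Finset.disjoint_left.1 hLN h heN
    have heD : e ∉ D := fun h => Finset.disjoint_left.1 hD h (Finset.mem_insert_self _ _)
    have heu : e ∉ l ∪ L := by simp [he, heL]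
    have hDN : ∀ i ∈ D, 1 ≤ u i := fun i hi => (hN i (by rw [← hDl]; simp [hi])).1
    have ih := ih (insert e D)
      (by
        rw [Finset.disjoint_left] at hD ⊢
        intro x hx hxl
        rcases Finset.mem_insert.1 hx with rfl | hx
        · exact he hxl
        · exact hD hx (Finset.mem_insert_of_mem hxl))
      (by rw [← hDl, Finset.insert_union, Finset.union_insert])
    obtain ⟨h1, h2⟩ := hN e heN
    have h0 := hu e
    rw [Finset.insert_union, X_insert _ _ _ _ _ heu, X_insert _ _ _ _ _ heu]
    have hT' := X_nonneg SimpleGraph.IsTree t (F ⊔ SimpleGraph.edge e.1 e.2) (l ∪ L) ht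
    have hK := K_nonneg u hu F D
    by_cases hr : F.Reachable e.1 e.2
    · rw [X_conn _ _ _ hr]
      have hKi : K u F (insert e D) = u e * K u F D := by
        simp [K, Finset.prod_insert heD, hr]
      have e1 : X SimpleGraph.Connected (fun e => u e - 1) F (l ∪ L)
          + (u e - 1) * X SimpleGraph.Connected (fun e => u e - 1) F (l ∪ L)
          = u e * X SimpleGraph.Connected (fun e => u e - 1) F (l ∪ L) := by ring
      have := ih F hF
      rw [hKi] at this
      rw [e1, abs_mul, abs_of_nonneg h0]
      have h3 := mul_nonneg hM (mul_nonneg (ht e) hT')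
      linarith
    · have hKi : K u F (insert e D) = K u F D := by
        simp [K, Finset.prod_insert heD, hr]
      have hKi' : K u (F ⊔ SimpleGraph.edge e.1 e.2) (insert e D)
          = u e * K u (F ⊔ SimpleGraph.edge e.1 e.2) D := by
        simp [K, Finset.prod_insert heD, reach_new F e.1 e.2]
      have hKm : K u F D ≤ K u (F ⊔ SimpleGraph.edge e.1 e.2) D := by
        refine Finset.prod_le_prod (fun i _ => ?_) (fun i hi => ?_)
        · split_ifs
          · exact hu i
          · exact zero_le_one
        · by_cases hi' : F.Reachable i.1 i.2
          · simp [hi', hi'.mono (le_sup_left : F ≤ F ⊔ SimpleGraph.edge e.1 e.2)]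
          · simp only [hi', if_false]
            split_ifs
            · exact hDN i hi
            · exact le_rfl
      have a1 := ih F hF
      have a2 := ih _ (acyc_sup hF hr)
      rw [hKi] at a1
      rw [hKi'] at a2
      set Y := X SimpleGraph.Connected (fun e => u e - 1) (F ⊔ SimpleGraph.edge e.1 e.2) (l ∪ L)
      have a3 : (u e - 1) * |Y| * K u F D
          ≤ t e * (M * X SimpleGraph.IsTree t (F ⊔ SimpleGraph.edge e.1 e.2) (l ∪ L)) := by
        refine le_trans ?_ (mul_le_mul_of_nonneg_left a2 (ht e))
        calc (u e - 1) * |Y| * K u F D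
            ≤ (t e * u e) * |Y| * K u (F ⊔ SimpleGraph.edge e.1 e.2) D := by
              refine mul_le_mul ?_ hKm hK ?_
              · exact mul_le_mul_of_nonneg_right h2 (abs_nonneg _)
              · exact mul_nonneg (mul_nonneg (ht e) h0) (abs_nonneg _)
          _ = _ := by ring
      have a4 := abs_add_le (X SimpleGraph.Connected (fun e => u e - 1) F (l ∪ L)) ((u e - 1) * Y)
      rw [abs_mul, abs_of_nonneg (by linarith : 0 ≤ u e - 1)] at a4
      have a5 := mul_le_mul_of_nonneg_right a4 hK
      linarith

/-- All ordered pairs. -/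
def allP (n : ℕ) : Finset (Fin n × Fin n) := Finset.univ.filter fun p => p.1 < p.2

lemma X_bot (P : SimpleGraph (Fin n) → Prop) [DecidablePred fun g => P g] (w : Fin n × Fin n → ℝ) :
    ∑ g ∈ (Finset.univ : Finset (SimpleGraph (Fin n))).filter (fun g => P g),
      ∏ p ∈ edgePairs g, w p = X P w ⊥ (allP n) := by
  unfold X
  rw [Finset.sum_filter]
  have hg : ∀ g : SimpleGraph (Fin n), gr (edgePairs g) = g := by
    intro g
    ext a b
    simp only [gr, edgePairs, SimpleGraph.fromEdgeSet_adj, Set.mem_image, Finset.mem_coe,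
      Finset.mem_filter, Finset.mem_univ, true_and, Prod.exists, Sym2.eq_iff]
    constructor
    · rintro ⟨⟨x, y, ⟨_, h⟩, ⟨rfl, rfl⟩ | ⟨rfl, rfl⟩⟩, _⟩
      · exact h
      · exact h.symm
    · intro h
      refine ⟨?_, h.ne⟩
      rcases lt_or_gt_of_ne h.ne with h' | h'
      · exact ⟨a, b, ⟨h', h⟩, Or.inl ⟨rfl, rfl⟩⟩
      · exact ⟨b, a, ⟨h', h.symm⟩, Or.inr ⟨rfl, rfl⟩⟩
  refine Finset.sum_bij' (fun g _ => edgePairs g) (fun A _ => gr A) ?_ ?_ ?_ ?_ ?_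
  · intro g _
    rw [Finset.mem_powerset]
    intro p hp
    simp only [edgePairs, allP, Finset.mem_filter, Finset.mem_univ, true_and] at hp ⊢
    exact hp.1
  · intro A _; exact Finset.mem_univ _
  · intro g _; exact hg g
  · intro A hA
    rw [Finset.mem_powerset] at hA
    have hA' : ∀ p ∈ A, p.1 < p.2 := fun p hp => by
      have := hA hp
      simpa [allP] using this
    ext ⟨a, b⟩
    simp only [gr, edgePairs, SimpleGraph.fromEdgeSet_adj, Set.mem_image, Finset.mem_coe,
      Finset.mem_filter, Finset.mem_univ, true_and, Prod.exists, Sym2.eq_iff]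
    constructor
    · rintro ⟨hab, ⟨x, y, h, ⟨rfl, rfl⟩ | ⟨rfl, rfl⟩⟩, _⟩
      · exact h
      · exact absurd (hA' _ h) (not_lt.2 hab.le)
    · intro h
      exact ⟨hA' _ h, ⟨a, b, h, Or.inl ⟨rfl, rfl⟩⟩, (hA' _ h).ne⟩
  · intro g _
    rw [bot_sup_eq, hg]
    by_cases h : P g
    · rw [if_pos h, if_pos h]
    · rw [if_neg h, if_neg h]

lemma expNeg_top : expNeg ⊤ = 0 := rfl
lemma expNeg_coe (a : ℝ) : expNeg (a : WithTop ℝ) = Real.exp (-a) := rfl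
lemma expNegAbs_top : expNegAbs ⊤ = 0 := rfl
lemma expNegAbs_coe (a : ℝ) : expNegAbs (a : WithTop ℝ) = Real.exp (-|a|) := rfl

lemma expNeg_add (a b : WithTop ℝ) : expNeg (a + b) = expNeg a * expNeg b := by
  induction a using WithTop.recTopCoe with
  | top => simp [expNeg_top]
  | coe a =>
    induction b using WithTop.recTopCoe with
    | top => simp [expNeg_top]
    | coe b =>
      rw [← WithTop.coe_add, expNeg_coe, expNeg_coe, expNeg_coe, ← Real.exp_add]
      congr 1; ring

lemma expNeg_zero : expNeg 0 = 1 := by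
  rw [← WithTop.coe_zero, expNeg_coe]; simp

lemma expNeg_sum {ι : Type*} (s : Finset ι) (f : ι → WithTop ℝ) :
    ∏ i ∈ s, expNeg (f i) = expNeg (∑ i ∈ s, f i) := by
  induction s using Finset.induction_on with
  | empty => simp [expNeg_zero]
  | insert a s ha ih => rw [Finset.prod_insert ha, Finset.sum_insert ha, expNeg_add, ih]

lemma expNeg_nonneg (a : WithTop ℝ) : 0 ≤ expNeg a := by
  induction a using WithTop.recTopCoe with
  | top => simp [expNeg_top]
  | coe a => rw [expNeg_coe]; positivity

lemma expNeg_le (b : ℝ) (a : WithTop ℝ) (h : ((-b : ℝ) : WithTop ℝ) ≤ a) :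
    expNeg a ≤ Real.exp b := by
  induction a using WithTop.recTopCoe with
  | top => rw [expNeg_top]; positivity
  | coe a =>
    rw [expNeg_coe]
    have := WithTop.coe_le_coe.1 h
    exact Real.exp_le_exp.2 (by linarith)

lemma t_nonneg (a : WithTop ℝ) : 0 ≤ 1 - expNegAbs a := by
  induction a using WithTop.recTopCoe with
  | top => simp [expNegAbs_top]
  | coe a =>
    rw [expNegAbs_coe, sub_nonneg, Real.exp_le_one_iff]
    simp

lemma t_pos (a : WithTop ℝ) (h : expNeg a ≤ 1) : 1 - expNeg a ≤ 1 - expNegAbs a := by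
  induction a using WithTop.recTopCoe with
  | top => simp [expNegAbs_top, expNeg_top]
  | coe a =>
    rw [expNeg_coe, Real.exp_le_one_iff] at h
    rw [expNegAbs_coe, expNeg_coe, abs_of_nonneg (by linarith)]

lemma t_neg (a : WithTop ℝ) (h : 1 < expNeg a) :
    expNeg a - 1 ≤ (1 - expNegAbs a) * expNeg a := by
  induction a using WithTop.recTopCoe with
  | top => rw [expNeg_top] at h; linarith
  | coe a =>
    rw [expNeg_coe, Real.one_lt_exp_iff] at h
    rw [expNegAbs_coe, expNeg_coe, abs_of_nonpos (by linarith), sub_mul, ← Real.exp_add]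
    simp

lemma stab (V : Sym2 (Fin n) → WithTop ℝ) (B : Fin n → ℝ)
    (hstab : ∀ S : Finset (Fin n),
      ((-(∑ i ∈ S, B i) : ℝ) : WithTop ℝ) ≤
        ∑ p ∈ Finset.univ.filter
            (fun p : Fin n × Fin n => p.1 < p.2 ∧ p.1 ∈ S ∧ p.2 ∈ S),
          V s(p.1, p.2)) (F : SimpleGraph (Fin n)) :
    K (fun p => expNeg (V s(p.1, p.2))) F (allP n) ≤ Real.exp (∑ i, B i) := by
  unfold K
  rw [← Finset.prod_filter]
  rw [← Finset.prod_fiberwise (g := fun p : Fin n × Fin n => F.connectedComponentMk p.1)]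
  rw [← Finset.sum_fiberwise (g := fun p : Fin n => F.connectedComponentMk p), Real.exp_sum]
  refine Finset.prod_le_prod (fun c _ => Finset.prod_nonneg fun _ _ => expNeg_nonneg _)
    (fun c _ => ?_)
  rw [expNeg_sum]
  refine expNeg_le _ _ ((hstab _).trans (le_of_eq ?_))
  refine Finset.sum_congr ?_ fun _ _ => rfl
  ext p
  simp only [allP, Finset.mem_filter, Finset.mem_univ, true_and]
  constructor
  · rintro ⟨h, h1, h2⟩
    exact ⟨⟨h, SimpleGraph.ConnectedComponent.exact (h1.trans h2.symm)⟩, h1⟩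
  · rintro ⟨⟨h, h1⟩, h2⟩
    exact ⟨h, h2, (SimpleGraph.ConnectedComponent.sound h1).symm.trans h2⟩

end TG

/-- Tree-graph inequality: if the weights `V_{ij} ∈ ℝ ∪ {+∞}` satisfy
`∑_{{i,j}⊆S} V_{ij} ≥ -∑_{i∈S} B_i` for every `S ⊆ {1,…,n}` (with `B_i ≥ 0`), then
`|∑_{g∈G_n} ∏_{{i,j}∈E_g}(e^{-V_{ij}}-1)|
   ≤ e^{∑ᵢ Bᵢ} ∑_{τ∈T_n} ∏_{{i,j}∈E_τ}(1-e^{-|V_{ij}|})`. -/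
theorem statement14 (n : ℕ) (hn : 2 ≤ n) (V : Sym2 (Fin n) → WithTop ℝ)
    (B : Fin n → ℝ) (hB : ∀ i, 0 ≤ B i)
    (hstab : ∀ S : Finset (Fin n),
      ((-(∑ i ∈ S, B i) : ℝ) : WithTop ℝ) ≤
        ∑ p ∈ Finset.univ.filter
            (fun p : Fin n × Fin n => p.1 < p.2 ∧ p.1 ∈ S ∧ p.2 ∈ S),
          V s(p.1, p.2)) :
    |∑ g ∈ (Finset.univ : Finset (SimpleGraph (Fin n))).filter (fun g => g.Connected),
        ∏ p ∈ edgePairs g, (expNeg (V s(p.1, p.2)) - 1)| ≤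
      Real.exp (∑ i, B i) *
        ∑ τ ∈ (Finset.univ : Finset (SimpleGraph (Fin n))).filter (fun τ => τ.IsTree),
          ∏ p ∈ edgePairs τ, (1 - expNegAbs (V s(p.1, p.2))) := by
  rw [TG.X_bot SimpleGraph.Connected (fun p => expNeg (V s(p.1, p.2)) - 1),
    TG.X_bot SimpleGraph.IsTree (fun p => 1 - expNegAbs (V s(p.1, p.2)))]
  let u : Fin n × Fin n → ℝ := fun p => expNeg (V s(p.1, p.2))
  let t : Fin n × Fin n → ℝ := fun p => 1 - expNegAbs (V s(p.1, p.2))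
  have hu : ∀ e, 0 ≤ u e := fun e => TG.expNeg_nonneg _
  have ht : ∀ e, 0 ≤ t e := fun e => TG.t_nonneg _
  let N := (TG.allP n).filter fun p => 1 < u p
  let L := (TG.allP n).filter fun p => ¬ 1 < u p
  have hNL : N ∪ L = TG.allP n := Finset.filter_union_filter_not_eq _ _
  have hdis : Disjoint L N := (Finset.disjoint_filter_filter_not _ _ _).symm
  have key := TG.phase1 u t hu ht (Real.exp (∑ i, B i)) (Real.exp_pos _).le L N hdis
    (fun e he => by
      have h := (Finset.mem_filter.1 he).2
      exact ⟨h.le, TG.t_neg _ h⟩)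
    (fun F hF => by
      have h2 := TG.phase2 u t hu ht L (fun e he => by
        have h := not_lt.1 (Finset.mem_filter.1 he).2
        exact ⟨h, TG.t_pos _ h⟩) F hF
      have hK := TG.K_nonneg u hu F N
      have hT := TG.X_nonneg SimpleGraph.IsTree t F L ht
      have hs := TG.stab V B hstab F
      have hsplit : TG.K u F (TG.allP n) = TG.K u F N * TG.K u F L := by
        rw [← hNL]
        exact Finset.prod_union hdis.symm
      change TG.K u F (TG.allP n) ≤ _ at hs
      rw [hsplit] at hs
      calc _ ≤ (TG.K u F L * TG.X SimpleGraph.IsTree t F L) * TG.K u F N :=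
            mul_le_mul_of_nonneg_right h2 hK
        _ = (TG.K u F N * TG.K u F L) * TG.X SimpleGraph.IsTree t F L := by ring
        _ ≤ _ := mul_le_mul_of_nonneg_right hs hT)
    N ∅ (Finset.disjoint_empty_left _) (Finset.empty_union _) ⊥ SimpleGraph.isAcyclic_bot
  rw [hNL] at key
  simpa [TG.K] using key

end
end

section
/- (Alternating sign of the Mayer series for repulsive potentials) Let V be a pair potential in dimension d with V(x) ≥ 0 for all x, and let β > 0. Then for every n ≥ 2 and all x_1, …, x_n ∈ ℝ^d, (−1)^{n−1} Φ^T(x_1, …, x_n) ≥ 0, i.e. Φ^T(x_1, …, x_n) = (−1)^{n−1} |Φ^T(x_1, …, x_n)|. Consequently, if in addition ∫_{ℝ^d} (1 − e^{−βV(x)}) dx < ∞, then for every bounded measurable Λ of positive volume, (−1)^{n−1} C_n(β, Λ) ≥ 0 for all n ≥ 1. -/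
open MeasureTheory
open scoped BigOperators

noncomputable section
open Classical

/-- The Ursell function
`Φ^T(x_1,…,x_n) = ∑_{g ∈ G_n} ∏_{{i,j} ∈ E_g} (e^{-βV(x_i-x_j)} - 1)`,
the sum running over all connected simple graphs on `{1,…,n}`. -/
def ursell {d : ℕ} (β : ℝ) (V : EuclideanSpace ℝ (Fin d) → ℝ) {n : ℕ}
    (x : Fin n → EuclideanSpace ℝ (Fin d)) : ℝ :=
  ∑ g ∈ (Finset.univ : Finset (SimpleGraph (Fin n))).filter (fun g => g.Connected),
    ∏ p ∈ edgePairs g, (Real.exp (-(β * V (x p.1 - x p.2))) - 1)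

/-- The `n`-th Mayer coefficient
`C_n(β,Λ) = (1/(n! |Λ|)) ∫_{Λ^n} Φ^T(x_1,…,x_n) dx_1⋯dx_n` for `n ≥ 2`, with `C_1 = 1`. -/
def mayerCoeff {d : ℕ} (β : ℝ) (V : EuclideanSpace ℝ (Fin d) → ℝ)
    (Λ : Set (EuclideanSpace ℝ (Fin d))) (n : ℕ) : ℝ :=
  if n ≤ 1 then 1
  else ((n.factorial : ℝ) * (volume Λ).toReal)⁻¹ *
    ∫ x in Set.univ.pi (fun _ : Fin n => Λ), ursell β V x

/-- Connectedness of the edge set `A` after identifying vertices with equal label `f`. -/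
def LabConn {α : Type*} (f : α → α) (A : Finset (α × α)) : Prop :=
  ∀ g : α → Prop, (∀ u v, f u = f v → (g u ↔ g v)) → (∀ p ∈ A, (g p.1 ↔ g p.2)) →
    ∀ u v, g u ↔ g v

/-- Contraction of the edge `e`: the label of `e.2` is replaced by that of `e.1`. -/
def contr {α : Type*} (f : α → α) (e : α × α) : α → α :=
  fun v => if f v = f e.2 then f e.1 else f v

theorem labConn_insert {α : Type*} (f : α → α) (e : α × α) (A : Finset (α × α)) :
    LabConn f (insert e A) ↔ LabConn (contr f e) A := by
  constructor
  · intro h g h1 h2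
    apply h g
    · intro u v huv
      apply h1
      simp [contr, huv]
    · intro p hp
      rcases Finset.mem_insert.1 hp with rfl | hp
      · apply h1
        simp [contr]
      · exact h2 p hp
  · intro h g h1 h2
    apply h g
    · intro u v huv
      have he := h2 e (Finset.mem_insert_self _ _)
      unfold contr at huv
      split_ifs at huv with a b b
      · exact h1 _ _ (a.trans b.symm)
      · exact (h1 _ _ a).trans (he.symm.trans (h1 _ _ huv))
      · exact (h1 _ _ huv).trans (he.trans (h1 _ _ b.symm))
      · exact h1 _ _ huv
    · intro p hp
      exact h2 p (Finset.mem_insert_of_mem hp)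

theorem contr_same {α : Type*} (f : α → α) (e : α × α) (h : f e.1 = f e.2) : contr f e = f := by
  funext v
  unfold contr
  split_ifs with a
  · rw [h, a]
  · rfl

theorem card_contr {α : Type*} [Fintype α] (f : α → α) (e : α × α) (h : f e.1 ≠ f e.2) :
    (Finset.univ.image f).card = (Finset.univ.image (contr f e)).card + 1 := by
  have : Finset.univ.image (contr f e) = (Finset.univ.image f).erase (f e.2) := by
    ext x
    simp only [Finset.mem_image, Finset.mem_univ, true_and, Finset.mem_erase]
    constructor
    · rintro ⟨a, rfl⟩
      unfold contr
      split_ifs with ha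
      · exact ⟨h, _, rfl⟩
      · exact ⟨ha, _, rfl⟩
    · rintro ⟨hx, a, rfl⟩
      exact ⟨a, by simp [contr, hx]⟩
  rw [this, Finset.card_erase_add_one (by simp)]

theorem labConn_empty {α : Type*} [Fintype α] [Nonempty α] (f : α → α) (h : LabConn f ∅) :
    (Finset.univ.image f).card = 1 := by
  obtain ⟨a⟩ := ‹Nonempty α›
  rw [Finset.card_eq_one]
  refine ⟨f a, ?_⟩
  ext x
  simp only [Finset.mem_image, Finset.mem_univ, true_and, Finset.mem_singleton]
  constructor
  · rintro ⟨b, rfl⟩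
    exact (h (fun x => f x = f a) (fun u v huv => by simp [huv]) (by simp) a b).1 rfl
  · rintro rfl
    exact ⟨a, rfl⟩

theorem mayer_sign_sum {α : Type*} [Fintype α] [Nonempty α] (w : α × α → ℝ)
    (hw0 : ∀ p, w p ≤ 0) (hw1 : ∀ p, 0 ≤ 1 + w p) (E : Finset (α × α)) :
    ∀ f : α → α, 0 ≤ (-1 : ℝ) ^ ((Finset.univ.image f).card + 1) *
      ∑ A ∈ E.powerset, if LabConn f A then ∏ p ∈ A, w p else 0 := by
  induction E using Finset.induction_on with
  | empty =>
    intro f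
    by_cases h : LabConn f ∅
    · simp [h, labConn_empty f h]
    · simp [h]
  | insert e E he ih =>
    intro f
    have key : (∑ A ∈ (insert e E).powerset, if LabConn f A then ∏ p ∈ A, w p else 0)
        = (∑ A ∈ E.powerset, if LabConn f A then ∏ p ∈ A, w p else 0)
          + w e * ∑ A ∈ E.powerset, if LabConn (contr f e) A then ∏ p ∈ A, w p else 0 := by
      rw [Finset.sum_powerset_insert he, Finset.mul_sum]
      congr 1
      apply Finset.sum_congr rfl
      intro A hA
      have : e ∉ A := fun h => he (Finset.mem_powerset.1 hA h)
      simp only [labConn_insert, Finset.prod_insert this, mul_ite, mul_zero]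
    rw [key]
    have h1 := ih f
    by_cases h : f e.1 = f e.2
    · rw [contr_same f e h]
      have := mul_nonneg (hw1 e) h1
      linarith
    · have h2 := ih (contr f e)
      rw [card_contr f e h] at h1 ⊢
      have := mul_nonneg (neg_nonneg.2 (hw0 e)) h2
      rw [pow_succ] at h1 ⊢
      linarith

theorem conn_iff {n : ℕ} (hn : 0 < n) (g : SimpleGraph (Fin n)) :
    g.Connected ↔ LabConn id (edgePairs g) := by
  have : Nonempty (Fin n) := ⟨⟨0, hn⟩⟩
  constructor
  · intro h q _ h2 u v
    obtain ⟨p⟩ := h.preconnected u v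
    induction p with
    | nil => rfl
    | @cons a b c hab _ ih =>
      refine Iff.trans ?_ ih
      rcases lt_trichotomy a b with hl | hl | hl
      · exact h2 (a, b) (by simp [edgePairs, hl, hab])
      · rw [hl]
      · exact (h2 (b, a) (by simp [edgePairs, hl, hab.symm])).symm
  · intro h
    refine ⟨fun u v => ?_⟩
    refine (h (fun x => g.Reachable u x) (fun a b hab => by simp_all) ?_ u v).1
      (SimpleGraph.Reachable.refl u)
    intro p hp
    simp only [edgePairs, Finset.mem_filter, Finset.mem_univ, true_and] at hp
    exact ⟨fun h => h.trans hp.2.reachable, fun h => h.trans hp.2.symm.reachable⟩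

theorem sum_graphs {n : ℕ} (hn : 0 < n) (w : Fin n × Fin n → ℝ) :
    (∑ g ∈ (Finset.univ : Finset (SimpleGraph (Fin n))).filter (fun g => g.Connected),
      ∏ p ∈ edgePairs g, w p) =
    ∑ A ∈ ((Finset.univ : Finset (Fin n × Fin n)).filter fun p => p.1 < p.2).powerset,
      if LabConn id A then ∏ p ∈ A, w p else 0 := by
  rw [Finset.sum_filter]
  refine Finset.sum_bij' (fun g _ => edgePairs g)
    (fun A _ => SimpleGraph.fromRel (fun a b => (a, b) ∈ A)) ?_ ?_ ?_ ?_ ?_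
  · intro g _
    rw [Finset.mem_powerset]
    intro p hp
    simp only [edgePairs, Finset.mem_filter, Finset.mem_univ, true_and] at hp ⊢
    exact hp.1
  · intro A _
    exact Finset.mem_univ _
  · intro g _
    ext a b
    simp only [SimpleGraph.fromRel_adj, edgePairs, Finset.mem_filter, Finset.mem_univ, true_and]
    constructor
    · rintro ⟨_, h | h⟩
      · exact h.2
      · exact h.2.symm
    · intro h
      refine ⟨h.ne, ?_⟩
      rcases lt_or_gt_of_ne h.ne with hl | hl
      · exact Or.inl ⟨hl, h⟩
      · exact Or.inr ⟨hl, h.symm⟩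
  · intro A hA
    ext ⟨a, b⟩
    have hlt : ∀ a b, (a, b) ∈ A → a < b := fun a b h => by
      have := Finset.mem_powerset.1 hA h
      simpa using this
    simp only [SimpleGraph.fromRel_adj, edgePairs, Finset.mem_filter, Finset.mem_univ, true_and]
    constructor
    · rintro ⟨h1, _, h | h⟩
      · exact h
      · exact absurd (hlt _ _ h) (lt_asymm h1)
    · intro h
      exact ⟨hlt _ _ h, (hlt _ _ h).ne, Or.inl h⟩
  · intro g _
    simp only [conn_iff hn g]

theorem card_id_image {α : Type*} [Fintype α] :
    (Finset.univ.image (id : α → α)).card = Fintype.card α := by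
  rw [Finset.image_id, Finset.card_univ]

theorem ursell_sign {d : ℕ} (β : ℝ) (hβ : 0 < β)
    (V : EuclideanSpace ℝ (Fin d) → ℝ) (hVpos : ∀ x, 0 ≤ V x) (n : ℕ) (hn : 2 ≤ n)
    (x : Fin n → EuclideanSpace ℝ (Fin d)) : 0 ≤ (-1 : ℝ) ^ (n - 1) * ursell β V x := by
  have : Nonempty (Fin n) := ⟨⟨0, by omega⟩⟩
  have h := mayer_sign_sum (fun p : Fin n × Fin n => Real.exp (-(β * V (x p.1 - x p.2))) - 1)
    (fun p => by
      have : Real.exp (-(β * V (x p.1 - x p.2))) ≤ 1 :=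
        Real.exp_le_one_iff.2 (neg_nonpos.2 (mul_nonneg hβ.le (hVpos _)))
      linarith)
    (fun p => by
      have := Real.exp_pos (-(β * V (x p.1 - x p.2)))
      linarith)
    (Finset.univ.filter fun p => p.1 < p.2) id
  rw [← sum_graphs (by omega)] at h
  have hc : n + 1 = (n - 1) + 2 := by omega
  rw [card_id_image, Fintype.card_fin, hc, pow_add] at h
  simpa [ursell] using h

/-- For a nonnegative (repulsive) pair potential, the Ursell functions alternate in sign:
`Φ^T = (-1)^{n-1} |Φ^T|`; consequently the Mayer series is alternating,
`(-1)^{n-1} C_n(β,Λ) ≥ 0`. -/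
theorem statement16 {d : ℕ} (β : ℝ) (hβ : 0 < β)
    (V : EuclideanSpace ℝ (Fin d) → ℝ) (hVmeas : Measurable V)
    (hVsymm : ∀ x, V (-x) = V x) (hVpos : ∀ x, 0 ≤ V x) :
    (∀ (n : ℕ), 2 ≤ n → ∀ x : Fin n → EuclideanSpace ℝ (Fin d),
      0 ≤ (-1 : ℝ) ^ (n - 1) * ursell β V x ∧
      ursell β V x = (-1 : ℝ) ^ (n - 1) * |ursell β V x|) ∧
    (Integrable (fun x : EuclideanSpace ℝ (Fin d) => 1 - Real.exp (-(β * V x))) →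
      ∀ Λ : Set (EuclideanSpace ℝ (Fin d)), MeasurableSet Λ → Bornology.IsBounded Λ →
        0 < volume Λ → ∀ n : ℕ, 1 ≤ n →
          0 ≤ (-1 : ℝ) ^ (n - 1) * mayerCoeff β V Λ n) := by
  refine ⟨fun n hn x => ?_, fun _ Λ _ _ _ n hn => ?_⟩
  · have h := ursell_sign β hβ V hVpos n hn x
    refine ⟨h, ?_⟩
    have h1 : |ursell β V x| = (-1 : ℝ) ^ (n - 1) * ursell β V x := by
      rw [← abs_of_nonneg h, abs_mul]
      simp
    rw [h1, ← mul_assoc, ← mul_pow]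
    simp
  · unfold mayerCoeff
    split_ifs with h
    · have : n = 1 := by omega
      subst this
      simp
    · rw [mul_left_comm, ← integral_const_mul]
      refine mul_nonneg (by positivity) (integral_nonneg fun x => ?_)
      exact ursell_sign β hβ V hVpos n (by omega) x


end
end

section
/- For every integer n ≥ 1, ∑_{g∈G_n} (−1)^{|E_g|} = (−1)^{n−1} (n−1)!, where the sum runs over all connected simple graphs g with vertex set {1, …, n} and |E_g| denotes the number of edges of g. -/
open scoped BigOperators

noncomputable section
open Classical

theorem sign_symmDiff {β : Type*} (s : Finset β) (p : β) (t : Finset β)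
    (ht : ∀ x, x ∈ t ↔ (x ∈ s ∧ x ≠ p ∨ x ∉ s ∧ x = p)) :
    (-1 : ℤ) ^ s.card + (-1 : ℤ) ^ t.card = 0 := by
  by_cases h : p ∈ s
  · have : t = s.erase p := by
      ext x; rw [ht, Finset.mem_erase]
      constructor
      · rintro (⟨a, b⟩ | ⟨a, rfl⟩)
        · exact ⟨b, a⟩
        · exact absurd h a
      · rintro ⟨a, b⟩; exact Or.inl ⟨b, a⟩
    rw [this, ← Finset.card_erase_add_one h, pow_succ]; ring
  · have : t = insert p s := by
      ext x; rw [ht, Finset.mem_insert]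
      constructor
      · rintro (⟨a, b⟩ | ⟨a, rfl⟩)
        · exact Or.inr a
        · exact Or.inl rfl
      · rintro (rfl | a)
        · exact Or.inr ⟨h, rfl⟩
        · exact Or.inl ⟨a, fun e => h (e ▸ a)⟩
    rw [this, Finset.card_insert_of_notMem h, pow_succ]; ring

/-- toggling the edge `ab` -/
def toggle {α : Type*} (a b : α) (hab : a ≠ b) (g : SimpleGraph α) : SimpleGraph α where
  Adj x y := (g.Adj x y ∧ ¬ ((x = a ∧ y = b) ∨ (x = b ∧ y = a))) ∨
    (¬ g.Adj x y ∧ ((x = a ∧ y = b) ∨ (x = b ∧ y = a)))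
  symm := ⟨by
    intro x y h
    rw [g.adj_comm y x]
    tauto⟩
  loopless := ⟨by
    intro x h
    rcases h with h | ⟨_, ⟨h1, h2⟩ | ⟨h1, h2⟩⟩
    · exact g.loopless.irrefl x h.1
    · exact hab (h1.symm.trans h2)
    · exact hab (h2.symm.trans h1)⟩

theorem toggle_toggle {α : Type*} (a b : α) (hab : a ≠ b) (g : SimpleGraph α) :
    toggle a b hab (toggle a b hab g) = g := by
  ext x y
  simp only [toggle]
  tauto

theorem sum_monochromatic {n q : ℕ} (f : Fin n → Fin q) :
    (∑ g ∈ (Finset.univ : Finset (SimpleGraph (Fin n))).filter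
      (fun g => ∀ a b, g.Adj a b → f a = f b), (-1 : ℤ) ^ (edgePairs g).card) =
      if Function.Injective f then 1 else 0 := by
  split_ifs with hf
  · have : (Finset.univ : Finset (SimpleGraph (Fin n))).filter
      (fun g => ∀ a b, g.Adj a b → f a = f b) = {⊥} := by
      ext g
      simp only [Finset.mem_filter, Finset.mem_univ, true_and, Finset.mem_singleton]
      constructor
      · intro h
        ext a b
        simp only [SimpleGraph.bot_adj, iff_false]
        intro hab
        exact hab.ne (hf (h a b hab))
      · rintro rfl a b h
        exact absurd h (by simp)
    rw [this]
    simp [edgePairs]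
  · obtain ⟨a, b, hlt, hfab⟩ : ∃ a b, a < b ∧ f a = f b := by
      simp only [Function.Injective] at hf
      push Not at hf
      obtain ⟨a, b, h, hne⟩ := hf
      rcases lt_or_gt_of_ne hne with h' | h'
      · exact ⟨a, b, h', h⟩
      · exact ⟨b, a, h', h.symm⟩
    have key : ∀ g : SimpleGraph (Fin n), (-1 : ℤ) ^ (edgePairs g).card +
        (-1 : ℤ) ^ (edgePairs (toggle a b hlt.ne g)).card = 0 := by
      intro g
      apply sign_symmDiff _ (a, b)
      rintro ⟨x, y⟩
      simp only [edgePairs, Finset.mem_filter, Finset.mem_univ, true_and, Prod.mk.injEq,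
        ne_eq]
      simp only [toggle]
      have h1 : x < y → ¬ (x = b ∧ y = a) := by
        rintro h ⟨rfl, rfl⟩
        exact absurd h hlt.asymm
      have h2 : x = a ∧ y = b → x < y := by
        rintro ⟨rfl, rfl⟩; exact hlt
      tauto
    refine Finset.sum_involution (fun g _ => toggle a b hlt.ne g) (fun g _ => key g) ?_ ?_ ?_
    · intro g _ _ h
      have := key g
      rw [h] at this
      have h0 : (-1 : ℤ) ^ (edgePairs g).card ≠ 0 := by simp
      omega
    · intro g hg
      simp only [Finset.mem_filter, Finset.mem_univ, true_and, toggle] at hg ⊢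
      rintro x y (h | ⟨_, ⟨rfl, rfl⟩ | ⟨rfl, rfl⟩⟩)
      · exact hg x y h.1
      · exact hfab
      · exact hfab.symm
    · intro g _
      exact toggle_toggle a b _ g

theorem card_colorings {n : ℕ} (q : ℕ) (g : SimpleGraph (Fin n)) :
    ((Finset.univ : Finset (Fin n → Fin q)).filter
      (fun f => ∀ a b, g.Adj a b → f a = f b)).card = q ^ Fintype.card g.ConnectedComponent := by
  have e : {f : Fin n → Fin q // ∀ a b, g.Adj a b → f a = f b} ≃
      (g.ConnectedComponent → Fin q) :=
    { toFun := fun f c => c.lift f.1 (by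
        intro v w p _
        clear * - p f
        induction p with
        | nil => rfl
        | cons h p ih =>
          rw [f.2 _ _ h]
          exact ih)
      invFun := fun F => ⟨fun v => F (g.connectedComponentMk v), fun a b h => by
        exact congrArg F (SimpleGraph.ConnectedComponent.connectedComponentMk_eq_of_adj h)⟩
      left_inv := fun f => rfl
      right_inv := fun F => by
        funext c
        induction c using SimpleGraph.ConnectedComponent.ind
        rfl }
  rw [← Fintype.card_subtype, Fintype.card_congr e]
  simp

open Polynomial in
theorem poly_identity (n : ℕ) :
    (∑ g : SimpleGraph (Fin n), C ((-1 : ℤ) ^ (edgePairs g).card) *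
      X ^ Fintype.card g.ConnectedComponent) = descPochhammer ℤ n := by
  apply Polynomial.eq_of_infinite_eval_eq
  apply Set.infinite_of_injective_forall_mem (f := fun q : ℕ => (q : ℤ)) Nat.cast_injective
  intro q
  simp only [Set.mem_ofPred_eq]
  rw [descPochhammer_eval_eq_descFactorial, Polynomial.eval_finsetSum]
  simp only [eval_mul, eval_C, eval_pow, eval_X]
  have h1 : ∀ g : SimpleGraph (Fin n), (-1 : ℤ) ^ (edgePairs g).card *
      (q : ℤ) ^ Fintype.card g.ConnectedComponent =
      ∑ f : Fin n → Fin q, if (∀ a b, g.Adj a b → f a = f b) then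
        (-1 : ℤ) ^ (edgePairs g).card else 0 := by
    intro g
    rw [← Finset.sum_filter, Finset.sum_const, card_colorings]
    simp [mul_comm]
  rw [Finset.sum_congr rfl (fun g _ => h1 g), Finset.sum_comm]
  simp only [← Finset.sum_filter]
  rw [Finset.sum_congr rfl (fun f _ => sum_monochromatic f), Finset.sum_boole]
  rw [← Fintype.card_subtype, Fintype.card_congr (Equiv.subtypeInjectiveEquivEmbedding _ _),
    Fintype.card_embedding_eq]
  simp

open Polynomial in
theorem desc_neg_one (n : ℕ) : (descPochhammer ℤ n).eval (-1) = (-1) ^ n * n.factorial := by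
  induction n with
  | zero => simp
  | succ n ih =>
    rw [descPochhammer_succ_right, eval_mul, ih, Nat.factorial_succ]
    simp
    ring

/-- For every `n ≥ 1`, `∑_{g ∈ G_n} (-1)^{|E_g|} = (-1)^{n-1} (n-1)!`, the sum running
over all connected simple graphs on `{1,…,n}`. -/
theorem statement17 (n : ℕ) (hn : 1 ≤ n) :
    (∑ g ∈ (Finset.univ : Finset (SimpleGraph (Fin n))).filter (fun g => g.Connected),
        (-1 : ℤ) ^ (edgePairs g).card) =
      (-1 : ℤ) ^ (n - 1) * (n - 1).factorial := by
  obtain ⟨m, rfl⟩ : ∃ m, n = m + 1 := ⟨n - 1, by omega⟩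
  have h := congrArg (fun p => Polynomial.coeff p 1) (poly_identity (m + 1))
  simp only [Polynomial.finsetSum_coeff, Polynomial.coeff_C_mul, Polynomial.coeff_X_pow] at h
  rw [descPochhammer_succ_left, Polynomial.coeff_X_mul, Polynomial.coeff_zero_eq_eval_zero,
    Polynomial.eval_comp] at h
  simp only [Polynomial.eval_sub, Polynomial.eval_X, Polynomial.eval_one, zero_sub,
    desc_neg_one] at h
  rw [Nat.add_sub_cancel, ← h, Finset.sum_filter]
  refine Finset.sum_congr rfl fun g _ => ?_
  have hc : g.Connected ↔ 1 = Fintype.card g.ConnectedComponent := by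
    rw [eq_comm, Fintype.card_eq_one_iff_nonempty_unique]
    constructor
    · intro hg
      refine ⟨⟨⟨g.connectedComponentMk 0⟩, fun c => ?_⟩⟩
      induction c using SimpleGraph.ConnectedComponent.ind
      exact SimpleGraph.ConnectedComponent.sound (hg.preconnected _ _)
    · rintro ⟨u⟩
      refine ⟨fun a b => SimpleGraph.ConnectedComponent.exact ?_⟩
      exact Subsingleton.elim _ _
  by_cases hg : g.Connected
  · rw [if_pos hg, if_pos (hc.1 hg), mul_one]
  · rw [if_neg hg, if_neg (fun h => hg (hc.2 h)), mul_zero]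

end
end
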